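/- arXiv:2407.10117 — 2 statements merged into one kernel-verified Lean document; each statement's English description precedes it below -/
import Mathlib

section
/- Let α ∈ (0,1) and 1 ≤ p, q ≤ ∞ with Hölder conjugates p*, q*. Suppose h ∈ H^{p,q}(S) and m with m − 𝓟_α ∈ H^{p*,q*}(S*) have boundary traces satisfying, almost everywhere on ℝ: [ h_0 = m_0 |m_0|^{p*−2} or m_0 = h_0 |h_0|^{p−2} ], and [ h_1 = −c · m_{−1} |m_{−1}|^{q*−2} or m_{−1} = −c^{1−q} · h_1 |h_1|^{q−2} ] for some constant c > 0. Then h attains the supremum H_{p,q}(α), and m attains the minimum of (‖m_0‖_{L^{p*}(ℝ)}/(1−α))^{1−α} (‖m_{−1}‖_{L^{q*}(ℝ)}/α)^{α} over all m with m − 𝓟_α ∈ H^{p*,q*}(S*). -/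
open MeasureTheory Complex Filter Set
open scoped Real ENNReal Topology

noncomputable section

def Strip : Set ℂ := {z : ℂ | 0 < z.im ∧ z.im < 1}

def bLine (h : ℂ → ℂ) (y : ℝ) : ℝ → ℂ := fun x => h (x + y * Complex.I)

def hardyNorm (p q : ℝ≥0∞) (h : ℂ → ℂ) : ℝ≥0∞ :=
  ⨆ y ∈ Set.Ioo (0:ℝ) 1,
    ⨅ (f : ℝ → ℂ) (g : ℝ → ℂ) (_ : Measurable f) (_ : Measurable g)
      (_ : f + g = bLine h y),
      ENNReal.ofReal (1 - y)⁻¹ * eLpNorm f p volume +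
        ENNReal.ofReal y⁻¹ * eLpNorm g q volume

def MemHardy (p q : ℝ≥0∞) (h : ℂ → ℂ) : Prop :=
  DifferentiableOn ℂ h Strip ∧ hardyNorm p q h < ⊤

def IsTrace0 (h : ℂ → ℂ) (v : ℝ → ℂ) : Prop :=
  ∀ φ : SchwartzMap ℝ ℂ,
    Tendsto (fun y : ℝ => ∫ x : ℝ, h (x + y * Complex.I) * (starRingEnd ℂ) (φ x))
      (𝓝[>] (0:ℝ)) (𝓝 (∫ x : ℝ, v x * (starRingEnd ℂ) (φ x)))

def IsTrace1 (h : ℂ → ℂ) (w : ℝ → ℂ) : Prop :=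
  ∀ φ : SchwartzMap ℝ ℂ,
    Tendsto (fun y : ℝ => ∫ x : ℝ, h (x + y * Complex.I) * (starRingEnd ℂ) (φ x))
      (𝓝[<] (1:ℝ)) (𝓝 (∫ x : ℝ, w x * (starRingEnd ℂ) (φ x)))

def ratioSet (p q : ℝ≥0∞) (α : ℝ) : Set ℝ :=
  { r | ∃ (h : ℂ → ℂ) (h0 h1 : ℝ → ℂ), MemHardy p q h ∧ (∃ z ∈ Strip, h z ≠ 0) ∧
      IsTrace0 h h0 ∧ IsTrace1 h h1 ∧ MemLp h0 p volume ∧ MemLp h1 q volume ∧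
      r = (eLpNorm (bLine h α) ⊤ volume).toReal /
        ((eLpNorm h0 p volume).toReal ^ (1 - α) * (eLpNorm h1 q volume).toReal ^ α) }

/-- `H_{p,q}(α)`: the optimal value of the generalized three lines problem. -/
def Hval (p q : ℝ≥0∞) (α : ℝ) : ℝ := sSup (ratioSet p q α)

def StripStar : Set ℂ := {z : ℂ | -1 < z.im ∧ z.im < 0}

def reflect (m : ℂ → ℂ) : ℂ → ℂ := fun z => (starRingEnd ℂ) (m ((starRingEnd ℂ) z))

/-- `m ∈ H^{p,q}(S*)` iff the reflected function `m*` belongs to `H^{p,q}(S)`. -/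
def MemHardyStar (p q : ℝ≥0∞) (m : ℂ → ℂ) : Prop := MemHardy p q (reflect m)

/-- trace of a function on `S*` along `ℝ` (limit `y ↑ 0`). -/
def IsTraceStar0 (m : ℂ → ℂ) (v : ℝ → ℂ) : Prop :=
  ∀ φ : SchwartzMap ℝ ℂ,
    Tendsto (fun y : ℝ => ∫ x : ℝ, m (x + y * Complex.I) * (starRingEnd ℂ) (φ x))
      (𝓝[<] (0:ℝ)) (𝓝 (∫ x : ℝ, v x * (starRingEnd ℂ) (φ x)))

/-- trace of a function on `S*` along `ℝ - i` (limit `y ↓ -1`). -/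
def IsTraceStarNeg1 (m : ℂ → ℂ) (w : ℝ → ℂ) : Prop :=
  ∀ φ : SchwartzMap ℝ ℂ,
    Tendsto (fun y : ℝ => ∫ x : ℝ, m (x + y * Complex.I) * (starRingEnd ℂ) (φ x))
      (𝓝[>] (-1:ℝ)) (𝓝 (∫ x : ℝ, w x * (starRingEnd ℂ) (φ x)))

/-- The Poisson kernel of the strip, as a meromorphic function of `z ∈ ℂ`. -/
def PoissonC (α : ℝ) (z : ℂ) : ℂ :=
  ((Real.sin (Real.pi * α) : ℝ) : ℂ) /
    (2 * (Complex.cosh ((Real.pi : ℂ) * z) - ((Real.cos (Real.pi * α) : ℝ) : ℂ)))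

/-- The admissible values of the dual problem over `m ∈ 𝓟_α + H^{p*,q*}(S*)`. -/
def dualSet (pst qst : ℝ≥0∞) (α : ℝ) : Set ℝ :=
  { r | ∃ (m : ℂ → ℂ) (m0 m1 : ℝ → ℂ),
      MemHardyStar pst qst (fun z => m z - PoissonC α z) ∧
      IsTraceStar0 m m0 ∧ IsTraceStarNeg1 m m1 ∧
      MemLp m0 pst volume ∧ MemLp m1 qst volume ∧
      r = ((eLpNorm m0 pst volume).toReal / (1 - α)) ^ (1 - α) *
          ((eLpNorm m1 qst volume).toReal / α) ^ α }

/-- complex mollification -/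
def Mo (φ : ℝ → ℝ) (h : ℂ → ℂ) (z : ℂ) : ℂ := ∫ t : ℝ, h (z - t) * (φ t : ℂ)
/-- real mollification -/
def mo (φ : ℝ → ℝ) (v : ℝ → ℂ) (x : ℝ) : ℂ := ∫ t : ℝ, v (x - t) * (φ t : ℂ)
/-- weak trace against real test functions -/
def WT (l : Filter ℝ) (h : ℂ → ℂ) (v : ℝ → ℂ) : Prop :=
  ∀ φ : ℝ → ℝ, ContDiff ℝ ((⊤ : ℕ∞) : WithTop ℕ∞) φ → HasCompactSupport φ →
    Tendsto (fun y : ℝ => ∫ x : ℝ, h (x + y * Complex.I) * (φ x : ℂ)) l (𝓝 (∫ x : ℝ, v x * (φ x : ℂ)))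

lemma isOpen_Strip : IsOpen Strip := by
  unfold Strip
  exact (isOpen_lt continuous_const Complex.continuous_im).inter
    (isOpen_lt Complex.continuous_im continuous_const)

lemma sub_mem_Strip {z : ℂ} (hz : z ∈ Strip) (t : ℝ) : z - t ∈ Strip := by
  simpa [Strip] using hz

lemma mem_Strip_xy {x y : ℝ} (hy : y ∈ Ioo (0:ℝ) 1) : (x + y * Complex.I : ℂ) ∈ Strip := by
  simpa [Strip] using hy

lemma Mo_diff {φ : ℝ → ℝ} (hφ : Continuous φ) (hc : HasCompactSupport φ) {h : ℂ → ℂ}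
    (hh : DifferentiableOn ℂ h Strip) : DifferentiableOn ℂ (Mo φ h) Strip := by
  intro z0 hz0
  apply DifferentiableAt.differentiableWithinAt
  obtain ⟨r, hr, hrs⟩ := Metric.nhds_basis_closedBall.mem_iff.1 (isOpen_Strip.mem_nhds hz0)
  have hK : IsCompact ((fun a : ℂ × ℝ => a.1 - (a.2 : ℂ)) '' (Metric.closedBall z0 r ×ˢ tsupport φ)) := by
    apply IsCompact.image ((isCompact_closedBall z0 r).prod hc)
    fun_prop
  have hKs : ((fun a : ℂ × ℝ => a.1 - (a.2 : ℂ)) '' (Metric.closedBall z0 r ×ˢ tsupport φ)) ⊆ Strip := by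
    rintro _ ⟨⟨z, t⟩, ⟨hz, -⟩, rfl⟩
    exact sub_mem_Strip (hrs hz) t
  have hd : ContinuousOn (deriv h) Strip := (hh.deriv isOpen_Strip).continuousOn
  obtain ⟨C, hC⟩ := hK.exists_bound_of_continuousOn (hd.mono hKs)
  have hcts : ∀ z ∈ Strip, Continuous (fun t : ℝ => z - (t : ℂ)) := fun z _ => by fun_prop
  have hF : ∀ z ∈ Strip, Continuous (fun t : ℝ => h (z - t) * (φ t : ℂ)) := fun z hz =>
    (hh.continuousOn.comp_continuous (hcts z hz) (fun t => sub_mem_Strip hz t)).mul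
      (continuous_ofReal.comp hφ)
  have hF' : ∀ z ∈ Strip, Continuous (fun t : ℝ => deriv h (z - t) * (φ t : ℂ)) := fun z hz =>
    (hd.comp_continuous (hcts z hz) (fun t => sub_mem_Strip hz t)).mul
      (continuous_ofReal.comp hφ)
  have hcs : HasCompactSupport (fun t : ℝ => (φ t : ℂ)) := hc.comp_left (g := fun x : ℝ => (x : ℂ)) (by simp)
  have key := hasDerivAt_integral_of_dominated_loc_of_deriv_le (μ := (volume : Measure ℝ))
    (F := fun z (t : ℝ) => h (z - t) * (φ t : ℂ)) (F' := fun z (t : ℝ) => deriv h (z - t) * (φ t : ℂ))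
    (x₀ := z0) (s := Metric.closedBall z0 r) (bound := fun t => C * ‖φ t‖)
    (Metric.closedBall_mem_nhds z0 hr) ?_ ?_ ?_ ?_ ?_ ?_
  · exact key.2.differentiableAt
  · filter_upwards [isOpen_Strip.mem_nhds hz0] with z hz using (hF z hz).aestronglyMeasurable
  · exact (hF z0 hz0).integrable_of_hasCompactSupport hcs.mul_left
  · exact (hF' z0 hz0).aestronglyMeasurable
  · refine Eventually.of_forall fun t z hz => ?_
    by_cases ht : t ∈ tsupport φ
    · rw [norm_mul]
      have := hC _ ⟨(z, t), ⟨hz, ht⟩, rfl⟩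
      simp only [Complex.norm_real]
      gcongr
    · simp [image_eq_zero_of_notMem_tsupport ht]
  · exact (hφ.norm.integrable_of_hasCompactSupport hc.norm).const_mul C
  · refine Eventually.of_forall fun t z hz => ?_
    have h1 : HasDerivAt h (deriv h (z - t)) (z - t) :=
      ((hh _ (sub_mem_Strip (hrs hz) t)).differentiableAt
        (isOpen_Strip.mem_nhds (sub_mem_Strip (hrs hz) t))).hasDerivAt
    have := (h1.comp_sub_const z (t : ℂ)).mul_const (φ t : ℂ)
    exact this

lemma Mo_tendsto {φ : ℝ → ℝ} (hφ : ContDiff ℝ ((⊤ : ℕ∞) : WithTop ℕ∞) φ) (hc : HasCompactSupport φ)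
    {h : ℂ → ℂ} {v : ℝ → ℂ} {l : Filter ℝ} (hw : WT l h v) (x : ℝ) :
    Tendsto (fun y : ℝ => Mo φ h (x + y * I)) l (𝓝 (mo φ v x)) := by
  have h1 := hw (fun s => φ (x - s)) (hφ.comp (by fun_prop))
    (hc.comp_homeomorph (Homeomorph.subLeft x))
  have e1 : ∀ y : ℝ, Mo φ h (x + y * I) = ∫ s : ℝ, h (s + y * I) * (φ (x - s) : ℂ) := by
    intro y
    unfold Mo
    rw [← integral_sub_left_eq_self _ _ x]
    congr 1; ext s
    congr 2
    push_cast; ring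
  have e2 : mo φ v x = ∫ s : ℝ, v s * (φ (x - s) : ℂ) := by
    unfold mo
    rw [← integral_sub_left_eq_self _ _ x]
    simp
  simp only [e1, e2]
  exact h1

lemma holder_bound {p q : ℝ≥0∞} [p.HolderTriple q 1] {f g : ℝ → ℂ} (hf : MemLp f p volume)
    (hg : MemLp g q volume) :
    ‖∫ x, f x * g x‖ ≤ (eLpNorm f p volume).toReal * (eLpNorm g q volume).toReal := by
  have h1 := eLpNorm_smul_le_mul_eLpNorm (p := p) (q := q) (r := 1) hg.1 hf.1
  have hi : Integrable (f * g) := hf.integrable_mul hg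
  calc ‖∫ x, f x * g x‖ ≤ ∫ x, ‖f x * g x‖ := norm_integral_le_integral_norm _
    _ = (eLpNorm (f • g) 1 volume).toReal := by
      rw [eLpNorm_one_eq_lintegral_enorm]; exact integral_norm_eq_lintegral_enorm hi.1
    _ ≤ _ := by
      rw [← ENNReal.toReal_mul]
      exact ENNReal.toReal_mono (ENNReal.mul_ne_top hf.2.ne hg.2.ne) h1

lemma hardy_decomp {p q : ℝ≥0∞} {h : ℂ → ℂ} (hh : MemHardy p q h) :
    ∃ C : ℝ, 0 ≤ C ∧ ∀ y ∈ Ioo (0:ℝ) 1, ∃ f g : ℝ → ℂ, MemLp f p volume ∧ MemLp g q volume ∧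
      (∀ x : ℝ, f x + g x = h (x + y * I)) ∧ (eLpNorm f p volume).toReal ≤ C ∧
      (eLpNorm g q volume).toReal ≤ C := by
  obtain ⟨hd, hn⟩ := hh
  refine ⟨(hardyNorm p q h).toReal + 1, by positivity, fun y hy => ?_⟩
  have h1 : (⨅ (f : ℝ → ℂ) (g : ℝ → ℂ) (_ : Measurable f) (_ : Measurable g)
      (_ : f + g = bLine h y),
      ENNReal.ofReal (1 - y)⁻¹ * eLpNorm f p volume +
        ENNReal.ofReal y⁻¹ * eLpNorm g q volume) ≤ hardyNorm p q h := by
    unfold hardyNorm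
    exact le_iSup₂_of_le y hy le_rfl
  have h2 := h1.trans_lt (ENNReal.lt_add_right hn.ne one_ne_zero)
  simp only [iInf_lt_iff] at h2
  obtain ⟨f, g, hf, hg, hfg, hlt⟩ := h2
  have hy1 : 1 ≤ ENNReal.ofReal (1 - y)⁻¹ := by
    rw [ENNReal.one_le_ofReal]
    exact (one_le_inv₀ (by linarith [hy.2])).2 (by linarith [hy.1])
  have hy2 : 1 ≤ ENNReal.ofReal y⁻¹ := by
    rw [ENNReal.one_le_ofReal]
    exact (one_le_inv₀ hy.1).2 hy.2.le
  have hne : hardyNorm p q h + 1 ≠ ⊤ := ENNReal.add_ne_top.2 ⟨hn.ne, ENNReal.one_ne_top⟩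
  have a1 : eLpNorm f p volume ≤ hardyNorm p q h + 1 :=
    (le_mul_of_one_le_left' hy1).trans (le_self_add.trans hlt.le)
  have a2 : eLpNorm g q volume ≤ hardyNorm p q h + 1 :=
    (le_mul_of_one_le_left' hy2).trans (le_add_self.trans hlt.le)
  have e : (hardyNorm p q h).toReal + 1 = (hardyNorm p q h + 1).toReal := by
    rw [ENNReal.toReal_add hn.ne ENNReal.one_ne_top]; simp
  refine ⟨f, g, ⟨hf.aestronglyMeasurable, a1.trans_lt hne.lt_top⟩,
    ⟨hg.aestronglyMeasurable, a2.trans_lt hne.lt_top⟩, fun x => ?_, ?_, ?_⟩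
  · exact congrFun hfg x
  · rw [e]; exact ENNReal.toReal_mono hne a1
  · rw [e]; exact ENNReal.toReal_mono hne a2

lemma memLp_comp_sub {p : ℝ≥0∞} {f : ℝ → ℂ} (hf : MemLp f p volume) (x : ℝ) :
    MemLp (fun t => f (x - t)) p volume :=
  hf.comp_measurePreserving (Measure.measurePreserving_sub_left volume x)

lemma eLpNorm_comp_sub {p : ℝ≥0∞} {f : ℝ → ℂ} (hf : MemLp f p volume) (x : ℝ) :
    eLpNorm (fun t => f (x - t)) p volume = eLpNorm f p volume :=
  eLpNorm_comp_measurePreserving hf.1 (Measure.measurePreserving_sub_left volume x)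

lemma memLp_test {φ : ℝ → ℝ} (hφ : Continuous φ) (hc : HasCompactSupport φ) (p : ℝ≥0∞) :
    MemLp (fun t => (φ t : ℂ)) p volume :=
  Continuous.memLp_of_hasCompactSupport (by fun_prop)
    (hc.comp_left (g := fun x : ℝ => (x : ℂ)) (by simp))

lemma mo_bound {φ : ℝ → ℝ} (hφ : Continuous φ) (hc : HasCompactSupport φ) {p p' : ℝ≥0∞}
    [p.HolderTriple p' 1] {f : ℝ → ℂ} (hf : MemLp f p volume) (x : ℝ) :
    ‖mo φ f x‖ ≤ (eLpNorm f p volume).toReal * (eLpNorm (fun t => (φ t : ℂ)) p' volume).toReal := by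
  have := holder_bound (p := p) (q := p') (memLp_comp_sub hf x) (memLp_test hφ hc p')
  rwa [eLpNorm_comp_sub hf] at this

lemma mo_integrable {φ : ℝ → ℝ} (hφ : Continuous φ) (hc : HasCompactSupport φ) {p p' : ℝ≥0∞}
    [p.HolderTriple p' 1] {f : ℝ → ℂ} (hf : MemLp f p volume) (x : ℝ) :
    Integrable (fun t => f (x - t) * (φ t : ℂ)) volume :=
  (memLp_comp_sub hf x).integrable_mul (memLp_test hφ hc p')

lemma Mo_bound {φ : ℝ → ℝ} (hφ : Continuous φ) (hc : HasCompactSupport φ) {p q p' q' : ℝ≥0∞}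
    [p.HolderTriple p' 1] [q.HolderTriple q' 1] {h : ℂ → ℂ} (hh : MemHardy p q h) :
    ∃ M : ℝ, 0 ≤ M ∧ ∀ z ∈ Strip, ‖Mo φ h z‖ ≤ M := by
  obtain ⟨C, hC0, hC⟩ := hardy_decomp hh
  refine ⟨C * (eLpNorm (fun t => (φ t : ℂ)) p' volume).toReal +
    C * (eLpNorm (fun t => (φ t : ℂ)) q' volume).toReal, by positivity, fun z hz => ?_⟩
  obtain ⟨f, g, hf, hg, hfg, hfC, hgC⟩ := hC z.im hz
  have e : Mo φ h z = mo φ f z.re + mo φ g z.re := by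
    unfold Mo mo
    rw [← integral_add (mo_integrable (p := p) (p' := p') hφ hc hf _) (mo_integrable (p := q) (p' := q') hφ hc hg _)]
    congr 1; ext t
    rw [← add_mul, hfg]
    congr 2
    conv_lhs => rw [← Complex.re_add_im z]
    push_cast; ring
  rw [e]
  refine (norm_add_le _ _).trans (add_le_add ?_ ?_)
  · exact (mo_bound (p' := p') hφ hc hf _).trans (by gcongr)
  · exact (mo_bound (p' := q') hφ hc hg _).trans (by gcongr)

lemma transl_tendsto {p : ℝ≥0∞} (hp1 : 1 ≤ p) (hp : p ≠ ⊤) {F : ℝ → ℂ} (hF : MemLp F p volume) :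
    Tendsto (fun t : ℝ => eLpNorm (fun x => F (x - t) - F x) p volume) (𝓝 0) (𝓝 0) := by
  have : Fact (1 ≤ p) := ⟨hp1⟩
  let g : C(ℝ, C(ℝ, ℝ)) := (ContinuousMap.mk (fun a : ℝ × ℝ => a.2 - a.1) (by fun_prop)).curry
  have hg : ∀ t, MeasurePreserving (g t) volume volume := fun t => measurePreserving_sub_right volume t
  have h1 := Filter.Tendsto.compMeasurePreservingLp (p := p) (l := 𝓝 (0:ℝ)) (f := fun _ => hF.toLp F)
    (g := g) (g₀ := g 0) tendsto_const_nhds (g.continuous.tendsto 0) hg (hg 0) hp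
  rw [Lp.tendsto_Lp_iff_tendsto_eLpNorm'] at h1
  refine h1.congr fun t => eLpNorm_congr_ae ?_
  have a1 : ∀ t, (Lp.compMeasurePreserving (g t) (hg t) (hF.toLp F) : ℝ → ℂ) =ᵐ[volume] fun x => F (x - t) := by
    intro t
    refine (Lp.coeFn_compMeasurePreserving (hF.toLp F) (hg t)).trans ?_
    exact (hg t).quasiMeasurePreserving.ae_eq_comp hF.coeFn_toLp
  filter_upwards [a1 t, a1 0] with x hx hx0
  simp only [Pi.sub_apply, hx, hx0, sub_zero]

lemma integ_mul {p q : ℝ≥0∞} [p.HolderTriple q 1] {F G : ℝ → ℂ}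
    (hF : MemLp F p volume) (hG : MemLp G q volume) : Integrable (fun x => F x * G x) volume :=
  hF.integrable_mul hG

lemma corr_tendsto_aux {p q : ℝ≥0∞} [p.HolderTriple q 1] (hp1 : 1 ≤ p) (hp : p ≠ ⊤) {F G : ℝ → ℂ}
    (hF : MemLp F p volume) (hG : MemLp G q volume) :
    Tendsto (fun t : ℝ => ∫ x, F (x - t) * G x) (𝓝 0) (𝓝 (∫ x, F x * G x)) := by
  rw [tendsto_iff_norm_sub_tendsto_zero]
  have hFt : ∀ t, MemLp (fun x => F (x - t)) p volume := fun t =>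
    hF.comp_measurePreserving (measurePreserving_sub_right volume t)
  have h1 := (ENNReal.tendsto_toReal ENNReal.zero_ne_top).comp (transl_tendsto hp1 hp hF)
  have h2 := h1.mul_const (eLpNorm G q volume).toReal
  simp only [ENNReal.toReal_zero, zero_mul] at h2
  refine squeeze_zero (fun _ => norm_nonneg _) (fun t => ?_) h2
  rw [← integral_sub (integ_mul (hFt t) hG) (integ_mul hF hG)]
  have := holder_bound ((hFt t).sub hF) hG
  refine le_trans (le_of_eq ?_) this
  congr 2; ext x; simp [sub_mul]

lemma corr_tendsto {p q : ℝ≥0∞} [hpq : p.HolderTriple q 1] (hp1 : 1 ≤ p) (hq1 : 1 ≤ q) {F G : ℝ → ℂ}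
    (hF : MemLp F p volume) (hG : MemLp G q volume) :
    Tendsto (fun t : ℝ => ∫ x, F (x - t) * G x) (𝓝 0) (𝓝 (∫ x, F x * G x)) := by
  by_cases hp : p = ⊤
  · have hq : q ≠ ⊤ := by
      rintro rfl
      have := hpq.inv_add_inv_eq_inv
      simp [hp] at this
    have : q.HolderTriple p 1 := ⟨by rw [add_comm]; exact hpq.inv_add_inv_eq_inv⟩
    have h1 := corr_tendsto_aux (p := q) (q := p) hq1 hq hG hF
    have h2 : Tendsto (fun t : ℝ => -t) (𝓝 0) (𝓝 0) := by simpa using (continuous_neg.tendsto (0:ℝ))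
    have h3 := h1.comp h2
    simp only [mul_comm (G _)] at h3
    refine h3.congr fun t => ?_
    simp only [Function.comp]
    rw [← integral_sub_right_eq_self _ t]
    simp
  · exact corr_tendsto_aux hp1 hp hF hG

lemma mo_fubini {p q : ℝ≥0∞} [hpq : p.HolderTriple q 1] {F G : ℝ → ℂ} {φ : ℝ → ℝ}
    (hφ : Continuous φ) (hc : HasCompactSupport φ)
    (hF : MemLp F p volume) (hG : MemLp G q volume) :
    Integrable (fun t => ∫ x, F (x - t) * (φ t : ℂ) * G x) volume ∧
    ∫ x, mo φ F x * G x = ∫ t, ∫ x, F (x - t) * (φ t : ℂ) * G x := by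
  have hFt : ∀ t, MemLp (fun x => F (x - t)) p volume := fun t =>
    hF.comp_measurePreserving (measurePreserving_sub_right volume t)
  have hn : ∀ t, eLpNorm (fun x => F (x - t)) p volume = eLpNorm F p volume := fun t =>
    eLpNorm_comp_measurePreserving hF.1 (measurePreserving_sub_right volume t)
  have hmeas : AEStronglyMeasurable (fun a : ℝ × ℝ => F (a.1 - a.2) * (φ a.2 : ℂ) * G a.1)
      ((volume : Measure ℝ).prod volume) := by
    refine AEStronglyMeasurable.mul (AEStronglyMeasurable.mul ?_ ?_) ?_
    · exact hF.1.comp_quasiMeasurePreserving (quasiMeasurePreserving_sub_of_right_invariant volume volume)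
    · exact (by fun_prop : Continuous fun a : ℝ × ℝ => (φ a.2 : ℂ)).aestronglyMeasurable
    · exact hG.1.comp_fst
  have hint : Integrable (fun a : ℝ × ℝ => F (a.1 - a.2) * (φ a.2 : ℂ) * G a.1)
      ((volume : Measure ℝ).prod volume) := by
    rw [integrable_prod_iff' hmeas]
    have hi : ∀ t, Integrable (fun x => F (x - t) * (φ t : ℂ) * G x) volume := fun t => by
      have := ((hFt t).integrable_mul hG).const_mul (φ t : ℂ)
      refine this.congr (Eventually.of_forall fun x => ?_)
      simp only [Pi.mul_apply]; ring
    refine ⟨Eventually.of_forall hi, ?_⟩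
    have hb : Integrable (fun t => (eLpNorm F p volume).toReal * (eLpNorm G q volume).toReal * ‖φ t‖) volume :=
      (hφ.norm.integrable_of_hasCompactSupport hc.norm).const_mul _
    refine hb.mono' hmeas.norm.prod_swap.integral_prod_right' (Eventually.of_forall fun t => ?_)
    have hnn : 0 ≤ ∫ x, ‖F (x - t) * (φ t : ℂ) * G x‖ := integral_nonneg fun _ => norm_nonneg _
    simp only [Real.norm_of_nonneg hnn]
    have h1 := eLpNorm_smul_le_mul_eLpNorm (p := p) (q := q) (r := 1) hG.1 (hFt t).1
    have hii : Integrable ((fun x => F (x - t)) * G) volume := (hFt t).integrable_mul hG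
    calc ∫ x, ‖F (x - t) * (φ t : ℂ) * G x‖ = ∫ x, ‖φ t‖ * ‖F (x - t) * G x‖ := by
          congr 1; ext x; simp only [norm_mul, Complex.norm_real]; ring
      _ = ‖φ t‖ * ∫ x, ‖F (x - t) * G x‖ := integral_const_mul _ _
      _ ≤ ‖φ t‖ * ((eLpNorm F p volume).toReal * (eLpNorm G q volume).toReal) := by
          gcongr
          calc ∫ x, ‖F (x - t) * G x‖ = (eLpNorm ((fun x => F (x - t)) • G) 1 volume).toReal := by
                rw [eLpNorm_one_eq_lintegral_enorm]
                exact integral_norm_eq_lintegral_enorm hii.1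
            _ ≤ _ := by
                rw [← ENNReal.toReal_mul, ← hn t]
                refine ENNReal.toReal_mono (ENNReal.mul_ne_top (hFt t).2.ne hG.2.ne) h1
      _ = _ := by ring
  refine ⟨hint.integral_prod_right, ?_⟩
  rw [← integral_integral_swap hint]
  congr 1; ext x
  unfold mo
  rw [← integral_mul_const]

/-- the bump -/
def cbmp (n : ℕ) : ContDiffBump (0:ℝ) :=
  ⟨1 / (2 * ((n:ℝ) + 1)), 1 / ((n:ℝ) + 1), by positivity, by
    apply one_div_lt_one_div_of_lt (by positivity); linarith [(Nat.cast_nonneg n : (0:ℝ) ≤ n)]⟩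

def bmp (n : ℕ) : ℝ → ℝ := (cbmp n).normed volume

lemma bmp_smooth (n : ℕ) : ContDiff ℝ ((⊤ : ℕ∞) : WithTop ℕ∞) (bmp n) := (cbmp n).contDiff_normed
lemma bmp_cont (n : ℕ) : Continuous (bmp n) := (cbmp n).continuous_normed
lemma bmp_supp (n : ℕ) : HasCompactSupport (bmp n) := (cbmp n).hasCompactSupport_normed
lemma bmp_nonneg (n : ℕ) (x : ℝ) : 0 ≤ bmp n x := (cbmp n).nonneg_normed x
lemma bmp_int (n : ℕ) : ∫ x, bmp n x = 1 := (cbmp n).integral_normed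
lemma bmp_zero (n : ℕ) (x : ℝ) (hx : 1 / ((n:ℝ) + 1) ≤ |x|) : bmp n x = 0 := by
  by_contra h
  have : x ∈ Function.support (bmp n) := h
  unfold bmp at this
  rw [ContDiffBump.support_normed_eq] at this
  simp only [Metric.mem_ball, dist_zero_right, Real.norm_eq_abs] at this
  exact absurd this (not_lt.2 hx)

lemma bmp_approx {K : ℝ → ℂ} {L : ℂ} (hK : Tendsto K (𝓝 0) (𝓝 L))
    (hi : ∀ n, Integrable (fun t => (bmp n t : ℂ) * K t) volume) :
    Tendsto (fun n => ∫ t, (bmp n t : ℂ) * K t) atTop (𝓝 L) := by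
  rw [Metric.tendsto_atTop]
  intro ε hε
  obtain ⟨δ, hδ, hd⟩ := Metric.tendsto_nhds_nhds.1 hK (ε / 2) (half_pos hε)
  obtain ⟨N, hN⟩ := exists_nat_one_div_lt hδ
  refine ⟨N, fun n hn => ?_⟩
  have hbi : Integrable (bmp n) volume := (bmp_cont n).integrable_of_hasCompactSupport (bmp_supp n)
  have e : L = ∫ t, (bmp n t : ℂ) * L := by
    rw [integral_mul_const, integral_complex_ofReal, bmp_int]; simp
  have hbi' : Integrable (fun t => (bmp n t : ℂ) * L) volume := hbi.ofReal.mul_const L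
  rw [dist_eq_norm]
  conv_lhs => rw [e]
  rw [← integral_sub (hi n) hbi']
  refine lt_of_le_of_lt (norm_integral_le_of_norm_le (hbi.mul_const (ε/2)) (Eventually.of_forall fun t => ?_)) ?_
  · rw [← mul_sub, norm_mul, Complex.norm_real, Real.norm_of_nonneg (bmp_nonneg n t)]
    by_cases ht : |t| < δ
    · have := hd (x := t) (by simpa using ht)
      rw [dist_eq_norm] at this
      exact mul_le_mul_of_nonneg_left this.le (bmp_nonneg n t)
    · rw [bmp_zero n t]
      · simp
      · refine le_trans ?_ (not_lt.1 ht)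
        refine le_trans ?_ hN.le
        apply one_div_le_one_div_of_le (by positivity)
        have : (N:ℝ) ≤ n := by exact_mod_cast hn
        linarith
  · rw [integral_mul_const, bmp_int]; linarith

lemma moll_tendsto {p q : ℝ≥0∞} [hpq : p.HolderTriple q 1] (hp1 : 1 ≤ p) (hq1 : 1 ≤ q) {F G : ℝ → ℂ}
    (hF : MemLp F p volume) (hG : MemLp G q volume) :
    Tendsto (fun n => ∫ x, mo (bmp n) F x * G x) atTop (𝓝 (∫ x, F x * G x)) := by
  have e : ∀ n t, ∫ x, F (x - t) * (bmp n t : ℂ) * G x = (bmp n t : ℂ) * ∫ x, F (x - t) * G x := by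
    intro n t
    rw [← integral_const_mul]
    congr 1; ext x; ring
  have hb := fun n => mo_fubini (bmp_cont n) (bmp_supp n) hF hG
  simp only [e] at hb
  have := bmp_approx (corr_tendsto hp1 hq1 hF hG) (fun n => (hb n).1)
  exact this.congr fun n => ((hb n).2).symm

lemma Mo_tendsto_point {h : ℂ → ℂ} (hh : DifferentiableOn ℂ h Strip) {z : ℂ} (hz : z ∈ Strip) :
    Tendsto (fun n => Mo (bmp n) h z) atTop (𝓝 (h z)) := by
  have hK : Continuous (fun t : ℝ => h (z - t)) :=
    hh.continuousOn.comp_continuous (by fun_prop) (fun t => sub_mem_Strip hz t)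
  have h0 := hK.tendsto 0
  simp only [ofReal_zero, sub_zero] at h0
  have := bmp_approx h0 (fun n => by
    have hcs : HasCompactSupport (fun t : ℝ => (bmp n t : ℂ)) :=
      (bmp_supp n).comp_left (g := fun x : ℝ => (x : ℂ)) (by simp)
    exact Continuous.integrable_of_hasCompactSupport
      ((continuous_ofReal.comp (bmp_cont n)).mul hK) hcs.mul_right)
  refine this.congr fun n => ?_
  unfold Mo
  congr 1; ext t; ring

lemma horiz {F : ℂ → ℂ} (hF : DifferentiableOn ℂ F Strip) {B : ℝ → ℝ} (hB : Integrable B volume)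
    (hB0 : Tendsto B atTop (𝓝 0)) (hB1 : Tendsto B atBot (𝓝 0))
    (hb : ∀ y ∈ Ioo (0:ℝ) 1, ∀ x : ℝ, ‖F (x + y * I)‖ ≤ B x) {a b : ℝ} (ha : a ∈ Ioo (0:ℝ) 1)
    (hb' : b ∈ Ioo (0:ℝ) 1) : ∫ x : ℝ, F (x + a * I) = ∫ x : ℝ, F (x + b * I) := by
  have hcont : ∀ y ∈ Ioo (0:ℝ) 1, Continuous (fun x : ℝ => F (x + y * I)) := fun y hy =>
    hF.continuousOn.comp_continuous (by fun_prop) (fun x => mem_Strip_xy hy)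
  have hint : ∀ y ∈ Ioo (0:ℝ) 1, Integrable (fun x : ℝ => F (x + y * I)) volume := fun y hy =>
    hB.mono' (hcont y hy).aestronglyMeasurable (Eventually.of_forall (hb y hy))
  have hsub : uIcc a b ⊆ Ioo (0:ℝ) 1 := by
    intro y hy
    rw [mem_uIcc] at hy
    rcases hy with hy | hy
    · exact ⟨ha.1.trans_le hy.1, hy.2.trans_lt hb'.2⟩
    · exact ⟨hb'.1.trans_le hy.1, hy.2.trans_lt ha.2⟩
  have rect : ∀ R : ℝ, (∫ x : ℝ in (-R)..R, F (x + a * I)) - (∫ x : ℝ in (-R)..R, F (x + b * I)) +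
      I • (∫ y : ℝ in a..b, F (R + y * I)) - I • (∫ y : ℝ in a..b, F ((-R : ℝ) + y * I)) = 0 := by
    intro R
    have := Complex.integral_boundary_rect_eq_zero_of_differentiableOn F ⟨-R, a⟩ ⟨R, b⟩ (hF.mono ?_)
    · exact this
    · intro z hz
      exact hsub hz.2
  have l1 : ∀ y ∈ Ioo (0:ℝ) 1, Tendsto (fun R : ℝ => ∫ x : ℝ in (-R)..R, F (x + y * I)) atTop
      (𝓝 (∫ x : ℝ, F (x + y * I))) := fun y hy =>
    intervalIntegral_tendsto_integral (hint y hy) tendsto_neg_atTop_atBot tendsto_id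
  have vb : ∀ R : ℝ, ‖∫ y : ℝ in a..b, F (R + y * I)‖ ≤ B R * |b - a| := fun R => by
    apply intervalIntegral.norm_integral_le_of_norm_le_const
    intro y hy
    exact hb y (hsub (uIoc_subset_uIcc hy)) R
  have l2 : Tendsto (fun R : ℝ => ∫ y : ℝ in a..b, F (R + y * I)) atTop (𝓝 0) := by
    refine squeeze_zero_norm vb ?_
    simpa using hB0.mul_const |b - a|
  have l3 : Tendsto (fun R : ℝ => ∫ y : ℝ in a..b, F ((-R : ℝ) + y * I)) atTop (𝓝 0) := by
    refine squeeze_zero_norm (fun R => vb (-R)) ?_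
    simpa using (hB1.comp tendsto_neg_atTop_atBot).mul_const |b - a|
  have l4 := ((l1 a ha).sub (l1 b hb')).add (l2.const_smul I) |>.sub (l3.const_smul I)
  simp only [rect, smul_zero, add_zero, sub_zero] at l4
  exact sub_eq_zero.1 (tendsto_nhds_unique l4 tendsto_const_nhds)

lemma Ioo_mem_0 : Ioo (0:ℝ) 1 ∈ 𝓝[>] (0:ℝ) := Ioo_mem_nhdsGT one_pos
lemma Ioo_mem_1 : Ioo (0:ℝ) 1 ∈ 𝓝[<] (1:ℝ) := Ioo_mem_nhdsLT one_pos

lemma contour {F : ℂ → ℂ} (hF : DifferentiableOn ℂ F Strip) {B : ℝ → ℝ} (hB : Integrable B volume)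
    (hB0 : Tendsto B atTop (𝓝 0)) (hB1 : Tendsto B atBot (𝓝 0))
    (hb : ∀ y ∈ Ioo (0:ℝ) 1, ∀ x : ℝ, ‖F (x + y * I)‖ ≤ B x) {F0 F1 : ℝ → ℂ}
    (h0 : ∀ x : ℝ, Tendsto (fun y : ℝ => F (x + y * I)) (𝓝[>] 0) (𝓝 (F0 x)))
    (h1 : ∀ x : ℝ, Tendsto (fun y : ℝ => F (x + y * I)) (𝓝[<] 1) (𝓝 (F1 x))) :
    ∫ x, F0 x = ∫ x, F1 x := by
  have hcont : ∀ y ∈ Ioo (0:ℝ) 1, Continuous (fun x : ℝ => F (x + y * I)) := fun y hy =>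
    hF.continuousOn.comp_continuous (by fun_prop) (fun x => mem_Strip_xy hy)
  have hhalf : (1/2 : ℝ) ∈ Ioo (0:ℝ) 1 := by norm_num
  have key : ∀ (l : Filter ℝ) [l.NeBot] [l.IsCountablyGenerated] (G : ℝ → ℂ), Ioo (0:ℝ) 1 ∈ l →
      (∀ x : ℝ, Tendsto (fun y : ℝ => F (x + y * I)) l (𝓝 (G x))) →
      ∫ x, G x = ∫ x : ℝ, F (x + (1/2 : ℝ) * I) := by
    intro l _ _ G hl hG
    have t1 : Tendsto (fun y : ℝ => ∫ x : ℝ, F (x + y * I)) l (𝓝 (∫ x, G x)) := by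
      apply tendsto_integral_filter_of_dominated_convergence B
      · filter_upwards [hl] with y hy using (hcont y hy).aestronglyMeasurable
      · filter_upwards [hl] with y hy using Eventually.of_forall (hb y hy)
      · exact hB
      · exact Eventually.of_forall hG
    have t2 : Tendsto (fun y : ℝ => ∫ x : ℝ, F (x + y * I)) l (𝓝 (∫ x : ℝ, F (x + (1/2 : ℝ) * I))) := by
      refine Tendsto.congr' ?_ tendsto_const_nhds
      filter_upwards [hl] with y hy using horiz hF hB hB0 hB1 hb hhalf hy
    exact tendsto_nhds_unique t1 t2
  rw [key _ F0 Ioo_mem_0 h0, key _ F1 Ioo_mem_1 h1]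

/-- the majorant -/
def maj (x : ℝ) : ℝ := (1 + x ^ 2)⁻¹

lemma maj_pos (x : ℝ) : 0 < maj x := by unfold maj; positivity
lemma maj_le_one (x : ℝ) : maj x ≤ 1 := by
  unfold maj; exact inv_le_one_of_one_le₀ (by nlinarith [sq_nonneg x])
lemma maj_cont : Continuous maj := by
  unfold maj; exact Continuous.inv₀ (by fun_prop) (fun x => by positivity)
lemma maj_int : Integrable maj volume := integrable_inv_one_add_sq
lemma maj_top : Tendsto maj atTop (𝓝 0) := by
  unfold maj
  exact tendsto_inv_atTop_zero.comp
    (tendsto_atTop_add_const_left _ _ (tendsto_pow_atTop two_ne_zero))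
lemma maj_bot : Tendsto maj atBot (𝓝 0) := by
  have := maj_top.comp tendsto_neg_atBot_atTop
  refine this.congr fun x => ?_
  simp [maj]

lemma memLp_maj {f : ℝ → ℂ} (hf : AEStronglyMeasurable f volume) {C : ℝ}
    (hb : ∀ x, ‖f x‖ ≤ C * maj x) (p : ℝ≥0∞) (hp : 1 ≤ p) : MemLp f p volume := by
  have h1 : MemLp maj p volume := by
    by_cases hpt : p = ⊤
    · rw [hpt]
      apply memLp_top_of_bound maj_cont.aestronglyMeasurable 1
      refine Eventually.of_forall fun x => ?_
      rw [Real.norm_of_nonneg (maj_pos x).le]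
      exact maj_le_one x
    · rw [← integrable_norm_rpow_iff maj_cont.aestronglyMeasurable (zero_lt_one.trans_le hp).ne' hpt]
      refine maj_int.mono' (maj_cont.norm.rpow_const (fun x => Or.inr ENNReal.toReal_nonneg)).aestronglyMeasurable
        (Eventually.of_forall fun x => ?_)
      have hr : 1 ≤ p.toReal := by
        rw [← ENNReal.toReal_one]; exact ENNReal.toReal_mono hpt hp
      rw [Real.norm_of_nonneg (maj_pos x).le, Real.norm_of_nonneg (Real.rpow_nonneg (maj_pos x).le _)]
      exact (Real.rpow_le_rpow_of_exponent_ge (maj_pos x) (maj_le_one x) hr).trans (by rw [Real.rpow_one])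
  refine h1.of_le_mul (c := C) hf (Eventually.of_forall fun x => ?_)
  rw [Real.norm_of_nonneg (maj_pos x).le]
  exact hb x

/-- denominator of the Poisson kernel -/
def Den (α : ℝ) (z : ℂ) : ℂ := Complex.cosh ((Real.pi : ℂ) * z) - ((Real.cos (Real.pi * α) : ℝ) : ℂ)

lemma Poisson_eq (α : ℝ) (z : ℂ) :
    PoissonC α z = ((Real.sin (Real.pi * α) : ℝ) : ℂ) / (2 * Den α z) := rfl

lemma Den_diff (α : ℝ) : Differentiable ℂ (Den α) := by
  unfold Den; fun_prop

lemma Den_xy (α x y : ℝ) : Den α (x + y * I) =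
    ((Real.cosh (π * x) * Real.cos (π * y) - Real.cos (π * α) : ℝ) : ℂ) +
      ((Real.sinh (π * x) * Real.sin (π * y) : ℝ) : ℂ) * I := by
  unfold Den
  have : (π : ℂ) * (x + y * I) = ((π * x : ℝ) : ℂ) + ((π * y : ℝ) : ℂ) * I := by push_cast; ring
  rw [this, Complex.cosh_add, Complex.cosh_mul_I, Complex.sinh_mul_I]
  push_cast; ring

lemma Den_normSq (α x y : ℝ) : ‖Den α (x + y * I)‖ ^ 2 =
    (Real.cosh (π * x) - Real.cos (π * y - π * α)) * (Real.cosh (π * x) - Real.cos (π * y + π * α)) := by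
  rw [Den_xy, Complex.sq_norm, Complex.normSq_add_mul_I, Real.cos_sub, Real.cos_add]
  have h1 := Real.cosh_sq (π * x)
  have h2 := Real.sin_sq (π * y)
  have h3 := Real.sin_sq (π * α)
  have h4 : Real.sinh (π * x) ^ 2 = Real.cosh (π * x) ^ 2 - 1 := by linarith
  have : (Real.sinh (π * x) * Real.sin (π * y)) ^ 2 =
    (Real.cosh (π * x) ^ 2 - 1) * (1 - Real.cos (π * y) ^ 2) := by rw [mul_pow, h4, h2]
  rw [this]
  have : (Real.cosh (π * x) - (Real.cos (π * y) * Real.cos (π * α) + Real.sin (π * y) * Real.sin (π * α))) *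
    (Real.cosh (π * x) - (Real.cos (π * y) * Real.cos (π * α) - Real.sin (π * y) * Real.sin (π * α))) =
    (Real.cosh (π * x) - Real.cos (π * y) * Real.cos (π * α)) ^ 2 -
      Real.sin (π * y) ^ 2 * Real.sin (π * α) ^ 2 := by ring
  rw [this, h2, h3]; ring

lemma Den_lower (α x y : ℝ) : Real.cosh (π * x) - 1 ≤ ‖Den α (x + y * I)‖ := by
  apply le_of_sq_le_sq _ (norm_nonneg _)
  rw [Den_normSq, sq]
  have h1 := Real.cos_le_one (π * y - π * α)
  have h2 := Real.cos_le_one (π * y + π * α)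
  have h3 := Real.one_le_cosh (π * x)
  apply mul_le_mul <;> linarith

lemma Den_ne {α x y : ℝ} (hα : α ∈ Ioo (0:ℝ) 1) (hy : y ∈ Icc (0:ℝ) 1)
    (hne : (x + y * I : ℂ) ≠ α * I) : Den α (x + y * I) ≠ 0 := by
  intro h0
  have h1 := Den_normSq α x y
  rw [h0, norm_zero] at h1
  have c1 := Real.cos_le_one (π * y - π * α)
  have c2 := Real.cos_le_one (π * y + π * α)
  have c3 := Real.one_le_cosh (π * x)
  have hpi := Real.pi_pos
  by_cases hx : x = 0
  · subst hx
    simp only [mul_zero, Real.cosh_zero] at h1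
    rcases mul_eq_zero.1 ((zero_pow two_ne_zero).symm.trans h1).symm with h2 | h2
    · have h3 : Real.cos (π * y - π * α) = 1 := by linarith
      rw [Real.cos_eq_one_iff_of_lt_of_lt] at h3
      · apply hne
        have : y = α := by
          have : π * (y - α) = 0 := by linarith
          rcases mul_eq_zero.1 this with h | h
          · exact absurd h hpi.ne'
          · linarith
        rw [this]; simp
      · nlinarith [hα.1, hα.2, hy.1, hy.2]
      · nlinarith [hα.1, hα.2, hy.1, hy.2]
    · have h3 : Real.cos (π * y + π * α - 2 * π) = 1 := by rw [Real.cos_sub_two_pi]; linarith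
      have h4 : Real.cos (π * y + π * α) = 1 := by linarith
      have hlt : π * y + π * α < 2 * π := by nlinarith [hα.1, hα.2, hy.1, hy.2]
      have hgt : 0 < π * y + π * α := by nlinarith [hα.1, hα.2, hy.1, hy.2, mul_pos hpi hα.1, mul_nonneg hpi.le hy.1]
      rw [Real.cos_eq_one_iff_of_lt_of_lt (by linarith) hlt] at h4
      linarith
  · have c4 : 1 < Real.cosh (π * x) := Real.one_lt_cosh.2 (mul_ne_zero hpi.ne' hx)
    have : 0 < (Real.cosh (π * x) - Real.cos (π * y - π * α)) * (Real.cosh (π * x) - Real.cos (π * y + π * α)) :=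
      mul_pos (by linarith) (by linarith)
    rw [← h1] at this
    simp at this

lemma Den_zero (α : ℝ) : Den α (α * I) = 0 := by
  have := Den_xy α 0 α
  simpa using this

lemma Den_deriv {α : ℝ} (hα : α ∈ Ioo (0:ℝ) 1) : deriv (Den α) (α * I) ≠ 0 := by
  have h1 : HasDerivAt (Den α) (Complex.sinh (π * (α * I)) * (π * 1)) (α * I) := by
    unfold Den
    exact (((hasDerivAt_id _).const_mul (π : ℂ)).ccosh).sub_const _
  rw [h1.deriv]
  have h2 : (π : ℂ) * (α * I) = ((π * α : ℝ) : ℂ) * I := by push_cast; ring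
  rw [h2, Complex.sinh_mul_I, ← Complex.ofReal_sin]
  have hs : Real.sin (π * α) ≠ 0 := (Real.sin_pos_of_pos_of_lt_pi (mul_pos Real.pi_pos hα.1)
    (by nlinarith [Real.pi_pos, hα.2])).ne'
  have : ((Real.sin (π * α) : ℝ) : ℂ) ≠ 0 := by exact_mod_cast hs
  have hp : (π : ℂ) ≠ 0 := by exact_mod_cast Real.pi_pos.ne'
  simp only [mul_one]
  exact mul_ne_zero (mul_ne_zero this I_ne_zero) hp

lemma sinpi_pos {α : ℝ} (hα : α ∈ Ioo (0:ℝ) 1) : 0 < Real.sin (π * α) :=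
  Real.sin_pos_of_pos_of_lt_pi (mul_pos Real.pi_pos hα.1) (by nlinarith [Real.pi_pos, hα.2])

lemma cosh_lower {x : ℝ} (hx : 1 ≤ |x|) : 1 + x ^ 2 ≤ Real.cosh (π * x) - 1 := by
  have h1 : 1 + (π * x) ^ 2 / 2 ≤ Real.cosh (π * x) := by
    have e : π * x = 2 * (π * x / 2) := by ring
    have a1 := Real.cosh_two_mul (π * x / 2)
    have a2 := Real.cosh_sq (π * x / 2)
    have a3 : (π * x / 2) ^ 2 ≤ Real.sinh (π * x / 2) ^ 2 := by
      rw [← sq_abs, ← sq_abs (Real.sinh _), Real.abs_sinh]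
      have := Real.self_le_sinh_iff.2 (abs_nonneg (π * x / 2))
      gcongr
    rw [← e] at a1
    nlinarith
  have h2 : 1 ≤ x ^ 2 := by rw [← sq_abs]; nlinarith
  have h3 : 9 ≤ π ^ 2 := by nlinarith [Real.pi_gt_three]
  have h4 : 9 * x ^ 2 ≤ π ^ 2 * x ^ 2 := by gcongr
  rw [mul_pow] at h1
  linarith

/-- uniform bound of the Poisson kernel on the closed strip, off a ball -/
lemma Poisson_bound {α : ℝ} (hα : α ∈ Ioo (0:ℝ) 1) {r : ℝ} (hr : 0 < r) :
    ∃ C : ℝ, 0 ≤ C ∧ ∀ x y : ℝ, y ∈ Icc (0:ℝ) 1 → r ≤ ‖(x + y * I - α * I : ℂ)‖ →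
      ‖PoissonC α (x + y * I)‖ ≤ C * maj x := by
  let K : Set (ℝ × ℝ) := {a ∈ Icc (-1:ℝ) 1 ×ˢ Icc (0:ℝ) 1 | r ≤ ‖(a.1 + a.2 * I - α * I : ℂ)‖}
  have hK : IsCompact K := by
    apply (isCompact_Icc.prod isCompact_Icc).inter_right
    exact isClosed_le (f := fun _ : ℝ × ℝ => r) (g := fun a : ℝ × ℝ => ‖(a.1 + a.2 * I - α * I : ℂ)‖)
      continuous_const (by fun_prop)
  have hne : ∀ x y : ℝ, y ∈ Icc (0:ℝ) 1 → r ≤ ‖(x + y * I - α * I : ℂ)‖ → Den α (x + y * I) ≠ 0 := by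
    intro x y hy hr'
    apply Den_ne hα hy
    intro h
    rw [h] at hr'
    simp at hr'; linarith
  have hcont : ContinuousOn (fun a : ℝ × ℝ => PoissonC α (a.1 + a.2 * I)) K := by
    simp only [Poisson_eq]
    apply ContinuousOn.div continuousOn_const
    · have := (Den_diff α).continuous
      fun_prop
    · rintro ⟨x, y⟩ ⟨hxy, hr'⟩
      exact mul_ne_zero two_ne_zero (hne x y hxy.2 hr')
  obtain ⟨C, hC⟩ := hK.exists_bound_of_continuousOn hcont
  refine ⟨max (2 * C) 1, by positivity, fun x y hy hr' => ?_⟩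
  by_cases hx : |x| ≤ 1
  · have h1 := hC (x, y) ⟨⟨abs_le.1 hx, hy⟩, hr'⟩
    have h2 : 1 / 2 ≤ maj x := by
      unfold maj
      rw [one_div]
      apply inv_anti₀ (by positivity)
      have : x ^ 2 ≤ 1 := by rw [← sq_abs]; nlinarith [abs_nonneg x]
      linarith
    have h0 : 0 ≤ C := (norm_nonneg _).trans h1
    have : (2 * C) ≤ max (2 * C) 1 := le_max_left _ _
    calc _ ≤ C := h1
      _ = 2 * C * (1/2) := by ring
      _ ≤ max (2 * C) 1 * maj x := by gcongr
  · have hx' : 1 ≤ |x| := (not_le.1 hx).le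
    have h1 := (cosh_lower hx').trans (Den_lower α x y)
    rw [Poisson_eq, norm_div, norm_mul, Complex.norm_real, Real.norm_of_nonneg (sinpi_pos hα).le]
    have hs := Real.sin_le_one (π * α)
    have hp : 0 < 1 + x ^ 2 := by positivity
    calc Real.sin (π * α) / (‖(2:ℂ)‖ * ‖Den α (x + y * I)‖) ≤ 1 / (1 + x ^ 2) := by
          apply div_le_div₀ zero_le_one hs hp
          simp only [Complex.norm_ofNat]
          nlinarith
      _ = 1 * maj x := by unfold maj; ring
      _ ≤ max (2 * C) 1 * maj x := by
          gcongr
          · exact (maj_pos x).le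
          · exact le_max_right _ _

lemma Poisson_contAt {α x y : ℝ} (hα : α ∈ Ioo (0:ℝ) 1) (hy : y ∈ Icc (0:ℝ) 1) (hne : y ≠ α) :
    ContinuousAt (PoissonC α) (x + y * I) := by
  have h : Den α (x + y * I) ≠ 0 := by
    apply Den_ne hα hy
    intro h
    have := congrArg Complex.im h
    simp at this
    exact hne this
  have h1 : PoissonC α = fun z => ((Real.sin (Real.pi * α) : ℝ) : ℂ) / (2 * Den α z) := rfl
  rw [h1]
  exact continuousAt_const.div (continuousAt_const.mul (Den_diff α).continuous.continuousAt)
    (mul_ne_zero two_ne_zero h)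

lemma Poisson_bound_low {α : ℝ} (hα : α ∈ Ioo (0:ℝ) 1) :
    ∃ C r : ℝ, 0 ≤ C ∧ 0 < r ∧ r < α ∧ r < 1 - α ∧ r < 1 ∧
      (∀ x y : ℝ, y ∈ Icc (0:ℝ) r → ‖PoissonC α (x + y * I)‖ ≤ C * maj x) ∧
      (∀ x y : ℝ, y ∈ Icc (1 - r) 1 → ‖PoissonC α (x + y * I)‖ ≤ C * maj x) := by
  obtain ⟨h0, h1⟩ := hα
  have hr : 0 < min α (1 - α) / 2 := by
    have := lt_min h0 (sub_pos.2 h1)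
    linarith
  have r1 : min α (1 - α) ≤ α := min_le_left _ _
  have r2 : min α (1 - α) ≤ 1 - α := min_le_right _ _
  set r := min α (1 - α) / 2 with hrd
  obtain ⟨C, hC, hb⟩ := Poisson_bound ⟨h0, h1⟩ hr
  have him : ∀ x y : ℝ, |y - α| ≤ ‖(x + y * I - α * I : ℂ)‖ := fun x y => by
    have := Complex.abs_im_le_norm (x + y * I - α * I : ℂ)
    simpa using this
  refine ⟨C, r, hC, hr, by linarith, by linarith, by linarith, fun x y hy => ?_, fun x y hy => ?_⟩
  · refine hb x y ⟨hy.1, by linarith [hy.2]⟩ (le_trans ?_ (him x y))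
    rw [abs_of_nonpos] <;> linarith [hy.2]
  · refine hb x y ⟨by linarith [hy.1], hy.2⟩ (le_trans ?_ (him x y))
    rw [abs_of_nonneg] <;> linarith [hy.1]

lemma Poisson_real {α : ℝ} (x : ℝ) : PoissonC α (x : ℂ) =
    ((Real.sin (π * α) / (2 * (Real.cosh (π * x) - Real.cos (π * α))) : ℝ) : ℂ) := by
  unfold PoissonC; push_cast; rfl

lemma Poisson_one {α : ℝ} (x : ℝ) : PoissonC α (x + I) = - PoissonC (1 - α) x := by
  have h1 : Den α (x + I) = - Den (1 - α) x := by
    have a := Den_xy α x 1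
    have b := Den_xy (1 - α) x 0
    simp only [ofReal_one, one_mul, mul_one, ofReal_zero, zero_mul, add_zero] at a b
    rw [a, b, mul_sub, mul_one, Real.cos_pi_sub]
    simp
    ring
  rw [Poisson_eq, Poisson_eq, h1, mul_sub, mul_one, Real.sin_pi_sub]
  rw [mul_neg, div_neg]

lemma Poisson_cont0 {α : ℝ} (hα : α ∈ Ioo (0:ℝ) 1) : Continuous (fun x : ℝ => PoissonC α x) := by
  rw [continuous_iff_continuousAt]
  intro x
  have := Poisson_contAt (x := x) (y := 0) hα (by simp) hα.1.ne
  simp only [ofReal_zero, zero_mul, add_zero] at this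
  exact ContinuousAt.comp (f := fun x : ℝ => (x : ℂ)) this continuous_ofReal.continuousAt

lemma Poisson_cont1 {α : ℝ} (hα : α ∈ Ioo (0:ℝ) 1) : Continuous (fun x : ℝ => PoissonC α (x + I)) := by
  simp only [Poisson_one]
  exact (Poisson_cont0 (α := 1 - α) ⟨by linarith [hα.2], by linarith [hα.1]⟩).neg

lemma Poisson_integrable {α : ℝ} (hα : α ∈ Ioo (0:ℝ) 1) : Integrable (fun x : ℝ => PoissonC α x) := by
  obtain ⟨C, r, hC, hr, -, -, -, hb, -⟩ := Poisson_bound_low hα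
  refine (maj_int.const_mul C).mono' (Poisson_cont0 hα).aestronglyMeasurable (Eventually.of_forall fun x => ?_)
  simpa using hb x 0 ⟨le_rfl, hr.le⟩

lemma Poisson_integral {α : ℝ} (hα : α ∈ Ioo (0:ℝ) 1) : ∫ x : ℝ, PoissonC α x = ((1 - α : ℝ) : ℂ) := by
  have hs := sinpi_pos hα
  have hpi := Real.pi_pos
  have hi := Poisson_integrable hα
  simp only [Poisson_real] at hi ⊢
  rw [integral_complex_ofReal]
  have hi' : Integrable (fun x : ℝ => Real.sin (π * α) / (2 * (Real.cosh (π * x) - Real.cos (π * α)))) := by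
    have := hi.re
    simpa only [RCLike.re_to_complex, Complex.ofReal_re] using this
  congr 1
  let f : ℝ → ℝ := fun x => π⁻¹ * Real.arctan ((Real.exp (π * x) - Real.cos (π * α)) / Real.sin (π * α))
  have hd : ∀ x, HasDerivAt f (Real.sin (π * α) / (2 * (Real.cosh (π * x) - Real.cos (π * α)))) x := by
    intro x
    have h1 : HasDerivAt (fun x : ℝ => (Real.exp (π * x) - Real.cos (π * α)) / Real.sin (π * α))
        (Real.exp (π * x) * (π * 1) / Real.sin (π * α)) x :=
      (((hasDerivAt_id x).const_mul π).exp.sub_const _).div_const _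
    have h2 := (h1.arctan).const_mul π⁻¹
    refine h2.congr_deriv ?_
    have hcosh : Real.cosh (π * x) = (Real.exp (π * x) + (Real.exp (π * x))⁻¹) / 2 := by
      rw [Real.cosh_eq, Real.exp_neg]
    have he : 0 < Real.exp (π * x) := Real.exp_pos _
    rw [hcosh]
    set e := Real.exp (π * x)
    have hsq := Real.sin_sq_add_cos_sq (π * α)
    set s := Real.sin (π * α)
    set c := Real.cos (π * α)
    have hpos : 0 < s ^ 2 + (e - c) ^ 2 := by positivity
    have e1 : 1 + ((e - c) / s) ^ 2 = (s ^ 2 + (e - c) ^ 2) / s ^ 2 := by field_simp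
    have e2 : 2 * ((e + e⁻¹) / 2 - c) = (s ^ 2 + (e - c) ^ 2) / e := by
      field_simp
      nlinarith
    rw [e1, e2]
    field_simp
  have lb : Tendsto f atBot (𝓝 (π⁻¹ * (π * α - π / 2))) := by
    have t1 : Tendsto (fun x : ℝ => Real.exp (π * x)) atBot (𝓝 0) :=
      Real.tendsto_exp_atBot.comp (tendsto_id.const_mul_atBot hpi)
    have t2 := ((t1.sub_const (Real.cos (π * α))).div_const (Real.sin (π * α)))
    have t3 := (Real.continuous_arctan.tendsto _).comp t2
    have e : Real.arctan ((0 - Real.cos (π * α)) / Real.sin (π * α)) = π * α - π / 2 := by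
      have : (0 - Real.cos (π * α)) / Real.sin (π * α) = Real.tan (π * α - π / 2) := by
        rw [Real.tan_eq_sin_div_cos, Real.sin_sub_pi_div_two, Real.cos_sub_pi_div_two, zero_sub]
      rw [this, Real.arctan_tan]
      · nlinarith [hα.1]
      · nlinarith [hα.2]
    rw [e] at t3
    exact t3.const_mul π⁻¹
  have lt : Tendsto f atTop (𝓝 (π⁻¹ * (π / 2))) := by
    have t1 : Tendsto (fun x : ℝ => Real.exp (π * x)) atTop atTop :=
      Real.tendsto_exp_atTop.comp (tendsto_id.const_mul_atTop hpi)
    have t2 := (tendsto_atTop_add_const_right _ (-Real.cos (π * α)) t1).atTop_div_const hs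
    have t3 := (tendsto_nhdsWithin_iff.1 Real.tendsto_arctan_atTop).1.comp t2
    exact t3.const_mul π⁻¹
  rw [integral_of_hasDerivAt_of_tendsto hd hi' lb lt]
  field_simp
  ring

lemma Poisson_total {α : ℝ} (hα : α ∈ Ioo (0:ℝ) 1) :
    (∫ x : ℝ, PoissonC α x) - ∫ x : ℝ, PoissonC α (x + I) = 1 := by
  have hα' : 1 - α ∈ Ioo (0:ℝ) 1 := ⟨by linarith [hα.2], by linarith [hα.1]⟩
  simp only [Poisson_one]
  rw [integral_neg, Poisson_integral hα, Poisson_integral hα']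
  push_cast; ring

lemma Poisson_memLp0 {α : ℝ} (hα : α ∈ Ioo (0:ℝ) 1) (p : ℝ≥0∞) (hp : 1 ≤ p) :
    MemLp (fun x : ℝ => PoissonC α x) p volume := by
  obtain ⟨C, r, hC, hr, -, -, -, hb, -⟩ := Poisson_bound_low hα
  refine memLp_maj (C := C) (Poisson_cont0 hα).aestronglyMeasurable (fun x => ?_) p hp
  simpa using hb x 0 ⟨le_rfl, hr.le⟩

lemma Poisson_memLp1 {α : ℝ} (hα : α ∈ Ioo (0:ℝ) 1) (p : ℝ≥0∞) (hp : 1 ≤ p) :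
    MemLp (fun x : ℝ => PoissonC α (x + I)) p volume := by
  simp only [Poisson_one]
  exact (Poisson_memLp0 (α := 1 - α) ⟨by linarith [hα.2], by linarith [hα.1]⟩ p hp).neg

lemma mo_meas {φ : ℝ → ℝ} (hφ : Continuous φ) {f : ℝ → ℂ} (hf : AEStronglyMeasurable f volume) :
    AEStronglyMeasurable (mo φ f) volume := by
  have hmeas : AEStronglyMeasurable (fun a : ℝ × ℝ => f (a.1 - a.2) * (φ a.2 : ℂ))
      ((volume : Measure ℝ).prod volume) := by
    refine AEStronglyMeasurable.mul ?_ ?_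
    · exact hf.comp_quasiMeasurePreserving (quasiMeasurePreserving_sub_of_right_invariant volume volume)
    · exact (by fun_prop : Continuous fun a : ℝ × ℝ => (φ a.2 : ℂ)).aestronglyMeasurable
  exact hmeas.integral_prod_right'

lemma holder_one_le {p q : ℝ≥0∞} [hpq : p.HolderTriple q 1] : 1 ≤ p ∧ 1 ≤ q := by
  have := hpq.inv_add_inv_eq_inv
  rw [inv_one] at this
  constructor
  · rw [← ENNReal.inv_le_one, ← this]; exact le_self_add
  · rw [← ENNReal.inv_le_one, ← this]; exact le_add_self

lemma memLp_mul_bdd {p : ℝ≥0∞} {f V : ℝ → ℂ} (hf : MemLp f p volume) (hV : Continuous V) {C : ℝ}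
    (hb : ∀ x, ‖V x‖ ≤ C) : MemLp (fun x => f x * V x) p volume := by
  refine hf.of_le_mul (c := C) (hf.1.mul hV.aestronglyMeasurable) (Eventually.of_forall fun x => ?_)
  rw [norm_mul, mul_comm]
  exact mul_le_mul_of_nonneg_right (hb x) (norm_nonneg _)

lemma side_b {p p' : ℝ≥0∞} [hpp : p.HolderTriple p' 1] {h0 n0 V : ℝ → ℂ} (hh : MemLp h0 p volume)
    (hn : MemLp n0 p' volume) (hV : Continuous V) {C : ℝ} (hb : ∀ x, ‖V x‖ ≤ C * maj x) (b : ℕ) :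
    Tendsto (fun a => ∫ x, mo (bmp a) h0 x * (mo (bmp b) n0 x * V x)) atTop
      (𝓝 (∫ x, h0 x * (mo (bmp b) n0 x * V x))) := by
  have : p'.HolderTriple p 1 := ⟨by rw [add_comm]; exact hpp.inv_add_inv_eq_inv⟩
  have h1 := holder_one_le (p := p) (q := p')
  refine moll_tendsto (p := p) (q := p') h1.1 h1.2 hh ?_
  set M := (eLpNorm n0 p' volume).toReal * (eLpNorm (fun t => (bmp b t : ℂ)) p volume).toReal
  refine memLp_maj (C := M * C) ((mo_meas (bmp_cont b) hn.1).mul hV.aestronglyMeasurable) (fun x => ?_) _ h1.2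
  rw [Pi.mul_apply, norm_mul, mul_assoc]
  have := mo_bound (p' := p) (bmp_cont b) (bmp_supp b) hn x
  exact mul_le_mul this (hb x) (norm_nonneg _) ((norm_nonneg _).trans this)

lemma side_c {p p' : ℝ≥0∞} [hpp : p.HolderTriple p' 1] {h0 n0 V : ℝ → ℂ} (hh : MemLp h0 p volume)
    (hn : MemLp n0 p' volume) (hV : Continuous V) {C : ℝ} (hb : ∀ x, ‖V x‖ ≤ C) :
    Tendsto (fun b => ∫ x, h0 x * (mo (bmp b) n0 x * V x)) atTop
      (𝓝 (∫ x, h0 x * n0 x * V x)) := by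
  have : p'.HolderTriple p 1 := ⟨by rw [add_comm]; exact hpp.inv_add_inv_eq_inv⟩
  have h1 := holder_one_le (p := p) (q := p')
  have := moll_tendsto (p := p') (q := p) h1.2 h1.1 hn (memLp_mul_bdd hh hV hb)
  have e1 : ∫ x, n0 x * (h0 x * V x) = ∫ x, h0 x * n0 x * V x := by
    congr 1; ext x; ring
  rw [e1] at this
  refine this.congr fun b => ?_
  congr 1; ext x; ring

/-- Gaussian cutoff -/
def Eg (k : ℕ) (z : ℂ) : ℂ := Complex.exp (-(z ^ 2) / ((k:ℂ) + 1))

lemma Eg_diff (k : ℕ) : Differentiable ℂ (Eg k) := by unfold Eg; fun_prop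

lemma Eg_norm (k : ℕ) (x y : ℝ) : ‖Eg k (x + y * I)‖ = Real.exp ((y ^ 2 - x ^ 2) / (k + 1)) := by
  unfold Eg
  rw [Complex.norm_exp]
  congr 1
  have : -((x + y * I : ℂ) ^ 2) / ((k:ℂ) + 1) = (((y ^ 2 - x ^ 2) / (k + 1) : ℝ) : ℂ) +
      ((-(2 * x * y) / (k + 1) : ℝ) : ℂ) * I := by
    have h1 : ((k:ℂ) + 1) ≠ 0 := by exact_mod_cast Nat.succ_ne_zero k
    push_cast
    field_simp
    ring_nf
    rw [I_sq]; ring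
  rw [this]
  simp only [add_re, mul_re, ofReal_re, ofReal_im, I_re, I_im]
  ring

lemma Eg_bound (k : ℕ) {x y : ℝ} (hy : y ∈ Icc (0:ℝ) 1) :
    ‖Eg k (x + y * I)‖ ≤ (Real.exp 1 * (k + 1)) * maj x := by
  rw [Eg_norm]
  have hk : (0:ℝ) < k + 1 := by positivity
  have hk1 : (1:ℝ) ≤ k + 1 := by linarith [(Nat.cast_nonneg k : (0:ℝ) ≤ k)]
  have e : (y ^ 2 - x ^ 2) / (k + 1) = y ^ 2 / (k + 1) + -(x ^ 2 / ((k:ℝ) + 1)) := by ring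
  rw [e, Real.exp_add, mul_assoc]
  have hy2 : y ^ 2 ≤ 1 := by nlinarith [hy.1, hy.2]
  gcongr
  · rw [div_le_one hk]; linarith
  · rw [Real.exp_neg]
    have h1 := Real.add_one_le_exp (x ^ 2 / ((k:ℝ) + 1))
    have h2 : 0 < x ^ 2 / ((k:ℝ) + 1) + 1 := by positivity
    calc (Real.exp (x ^ 2 / ((k:ℝ) + 1)))⁻¹ ≤ (x ^ 2 / ((k:ℝ) + 1) + 1)⁻¹ := inv_anti₀ h2 h1
      _ = (k + 1) * (x ^ 2 + (k + 1))⁻¹ := by field_simp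
      _ ≤ (k + 1) * maj x := by
        unfold maj
        gcongr ?_ * ?_⁻¹
        linarith

lemma Eg_bound' (k : ℕ) {x y : ℝ} (hy : y ∈ Icc (0:ℝ) 1) :
    ‖Eg k (x + y * I)‖ ≤ Real.exp 1 := by
  rw [Eg_norm]
  have hk1 : (1:ℝ) ≤ k + 1 := by linarith [(Nat.cast_nonneg k : (0:ℝ) ≤ k)]
  have hy2 : y ^ 2 ≤ 1 := by nlinarith [hy.1, hy.2]
  gcongr
  rw [div_le_one (by linarith)]
  nlinarith [sq_nonneg x]

lemma Eg_tendsto (z : ℂ) : Tendsto (fun k => Eg k z) atTop (𝓝 1) := by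
  unfold Eg
  have h1 : Tendsto (fun k : ℕ => ((k:ℂ) + 1)⁻¹) atTop (𝓝 0) := by
    have := tendsto_one_div_add_atTop_nhds_zero_nat (𝕜 := ℂ)
    simpa using this
  have h2 := (h1.const_mul (-(z^2)))
  rw [mul_zero] at h2
  have h3 := (Complex.continuous_exp.tendsto 0).comp h2
  rw [Complex.exp_zero] at h3
  exact h3

lemma side_d {p p' : ℝ≥0∞} [hpp : p.HolderTriple p' 1] {h0 n0 W : ℝ → ℂ} {y : ℝ} (hy : y ∈ Icc (0:ℝ) 1)
    (hh : MemLp h0 p volume)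
    (hn : MemLp n0 p' volume) (hW : Continuous W) {C : ℝ} (hb : ∀ x, ‖W x‖ ≤ C) :
    Tendsto (fun k => ∫ x : ℝ, h0 x * n0 x * (W x * Eg k (x + y * I))) atTop
      (𝓝 (∫ x, h0 x * n0 x * W x)) := by
  have hi := (integ_mul hh hn)
  have hE : ∀ k, Continuous (fun x : ℝ => Eg k (x + y * I)) := fun k => by
    have := (Eg_diff k).continuous
    fun_prop
  have hC : 0 ≤ C := (norm_nonneg _).trans (hb 0)
  apply tendsto_integral_of_dominated_convergence (fun x => ‖h0 x * n0 x‖ * (C * Real.exp 1))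
  · intro k
    exact hi.1.mul (hW.mul (hE k)).aestronglyMeasurable
  · exact hi.norm.mul_const _
  · intro k
    refine Eventually.of_forall fun x => ?_
    rw [norm_mul, norm_mul (W x)]
    gcongr
    · exact hb x
    · exact Eg_bound' k hy
  · refine Eventually.of_forall fun x => ?_
    have := ((Eg_tendsto (x + y * I)).const_mul (W x)).const_mul (h0 x * n0 x)
    simpa using this

lemma lim0 {G : ℂ → ℂ} (hG : Continuous G) (x : ℝ) :
    Tendsto (fun y : ℝ => G (x + y * I)) (𝓝[>] 0) (𝓝 (G x)) := by
  have h1 : Continuous (fun y : ℝ => G (x + y * I)) := by fun_prop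
  have := (h1.tendsto 0).mono_left (nhdsWithin_le_nhds (s := Ioi 0))
  simpa using this

lemma lim1 {G : ℂ → ℂ} (hG : Continuous G) (x : ℝ) :
    Tendsto (fun y : ℝ => G (x + y * I)) (𝓝[<] 1) (𝓝 (G (x + I))) := by
  have h1 : Continuous (fun y : ℝ => G (x + y * I)) := by fun_prop
  have := (h1.tendsto 1).mono_left (nhdsWithin_le_nhds (s := Iio 1))
  simpa using this

lemma ident1 {p q p' q' : ℝ≥0∞} [hpp : p.HolderTriple p' 1] [hqq : q.HolderTriple q' 1]
    {h n W : ℂ → ℂ} {h0 h1 n0 n1 : ℝ → ℂ} (hh : MemHardy p q h) (hn : MemHardy p' q' n)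
    (th0 : WT (𝓝[>] 0) h h0) (th1 : WT (𝓝[<] 1) h h1)
    (tn0 : WT (𝓝[>] 0) n n0) (tn1 : WT (𝓝[<] 1) n n1)
    (lh0 : MemLp h0 p volume) (lh1 : MemLp h1 q volume)
    (ln0 : MemLp n0 p' volume) (ln1 : MemLp n1 q' volume)
    (hW : Differentiable ℂ W) {C : ℝ} (hb : ∀ x y : ℝ, y ∈ Icc (0:ℝ) 1 → ‖W (x + y * I)‖ ≤ C) :
    ∫ x : ℝ, h0 x * n0 x * W x = ∫ x : ℝ, h1 x * n1 x * W (x + I) := by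
  have hC : 0 ≤ C := (norm_nonneg _).trans (hb 0 0 (by simp))
  have : p'.HolderTriple p 1 := ⟨by rw [add_comm]; exact hpp.inv_add_inv_eq_inv⟩
  have : q'.HolderTriple q 1 := ⟨by rw [add_comm]; exact hqq.inv_add_inv_eq_inv⟩
  have hWc := hW.continuous
  have hb0 : ∀ x : ℝ, ‖W x‖ ≤ C := fun x => by simpa using hb x 0 (by simp)
  have hb1 : ∀ x : ℝ, ‖W (x + I)‖ ≤ C := fun x => by simpa using hb x 1 (by simp)
  have key : ∀ k : ℕ, ∫ x : ℝ, h0 x * n0 x * (W x * Eg k x) =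
      ∫ x : ℝ, h1 x * n1 x * (W (x + I) * Eg k (x + I)) := by
    intro k
    have hEc := (Eg_diff k).continuous
    set D : ℝ := C * (Real.exp 1 * (k + 1)) with hD
    have hD0 : 0 ≤ D := by positivity
    have hWE : ∀ x y : ℝ, y ∈ Icc (0:ℝ) 1 → ‖W (x + y * I) * Eg k (x + y * I)‖ ≤ D * maj x := by
      intro x y hy
      rw [norm_mul, hD, mul_assoc]
      exact mul_le_mul (hb x y hy) (Eg_bound k hy) (norm_nonneg _) hC
    have v0 : ∀ x : ℝ, ‖W x * Eg k x‖ ≤ D * maj x := fun x => by simpa using hWE x 0 (by simp)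
    have v1 : ∀ x : ℝ, ‖W (x + I) * Eg k (x + I)‖ ≤ D * maj x := fun x => by simpa using hWE x 1 (by simp)
    have mj : ∀ x, D * maj x ≤ D := fun x => mul_le_of_le_one_right hD0 (maj_le_one x)
    have c0 : Continuous (fun x : ℝ => W x * Eg k x) := by fun_prop
    have c1 : Continuous (fun x : ℝ => W (x + I) * Eg k (x + I)) := by fun_prop
    have s1 : ∀ a b : ℕ, ∫ x : ℝ, mo (bmp a) h0 x * (mo (bmp b) n0 x * (W x * Eg k x)) =
        ∫ x : ℝ, mo (bmp a) h1 x * (mo (bmp b) n1 x * (W (x + I) * Eg k (x + I))) := by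
      intro a b
      obtain ⟨M, hM0, hM⟩ := Mo_bound (p' := p') (q' := q') (bmp_cont a) (bmp_supp a) hh
      obtain ⟨M', hM0', hM'⟩ := Mo_bound (p' := p) (q' := q) (bmp_cont b) (bmp_supp b) hn
      have hB0 := maj_top.const_mul (M * (M' * D))
      have hB1 := maj_bot.const_mul (M * (M' * D))
      rw [mul_zero] at hB0 hB1
      refine contour (F := fun z => Mo (bmp a) h z * (Mo (bmp b) n z * (W z * Eg k z))) ?_
        (B := fun x => (M * (M' * D)) * maj x) (maj_int.const_mul _) hB0 hB1 ?_ ?_ ?_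
      · exact (Mo_diff (bmp_cont a) (bmp_supp a) hh.1).mul
          ((Mo_diff (bmp_cont b) (bmp_supp b) hn.1).mul (hW.mul (Eg_diff k)).differentiableOn)
      · intro y hy x
        rw [norm_mul, norm_mul (Mo (bmp b) n _), mul_assoc, mul_assoc]
        gcongr
        · exact hM _ (mem_Strip_xy hy)
        · exact hM' _ (mem_Strip_xy hy)
        · exact hWE x y ⟨hy.1.le, hy.2.le⟩
      · intro x
        exact (Mo_tendsto (bmp_smooth a) (bmp_supp a) th0 x).mul
          ((Mo_tendsto (bmp_smooth b) (bmp_supp b) tn0 x).mul ((lim0 hWc x).mul (lim0 hEc x)))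
      · intro x
        exact (Mo_tendsto (bmp_smooth a) (bmp_supp a) th1 x).mul
          ((Mo_tendsto (bmp_smooth b) (bmp_supp b) tn1 x).mul ((lim1 hWc x).mul (lim1 hEc x)))
    have s2 : ∀ b : ℕ, ∫ x : ℝ, h0 x * (mo (bmp b) n0 x * (W x * Eg k x)) =
        ∫ x : ℝ, h1 x * (mo (bmp b) n1 x * (W (x + I) * Eg k (x + I))) := fun b =>
      tendsto_nhds_unique (side_b lh0 ln0 c0 v0 b)
        ((side_b lh1 ln1 c1 v1 b).congr fun a => (s1 a b).symm)
    exact tendsto_nhds_unique (side_c lh0 ln0 c0 (fun x => (v0 x).trans (mj x)))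
        ((side_c lh1 ln1 c1 (fun x => (v1 x).trans (mj x))).congr fun a => (s2 a).symm)
  have d0 := side_d (y := 0) (by simp) lh0 ln0 (W := fun x : ℝ => W x) (by fun_prop) hb0
  have d1 := side_d (y := 1) (by simp) lh1 ln1 (W := fun x : ℝ => W (x + I)) (by fun_prop) hb1
  simp only [ofReal_zero, zero_mul, add_zero, ofReal_one, one_mul] at d0 d1
  exact tendsto_nhds_unique d0 (d1.congr fun k => (key k).symm)

lemma resid {α : ℝ} (hα : α ∈ Ioo (0:ℝ) 1) {N : ℂ → ℂ} (hN : DifferentiableOn ℂ N Strip) {M : ℝ}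
    (hM : ∀ z ∈ Strip, ‖N z‖ ≤ M) {N0 N1 : ℝ → ℂ}
    (h0 : ∀ x : ℝ, Tendsto (fun y : ℝ => N (x + y * I)) (𝓝[>] 0) (𝓝 (N0 x)))
    (h1 : ∀ x : ℝ, Tendsto (fun y : ℝ => N (x + y * I)) (𝓝[<] 1) (𝓝 (N1 x)))
    (i0 : Integrable (fun x : ℝ => N0 x * PoissonC α x) volume)
    (i1 : Integrable (fun x : ℝ => N1 x * PoissonC α (x + I)) volume) :
    (∫ x : ℝ, N0 x * PoissonC α x) - ∫ x : ℝ, N1 x * PoissonC α (x + I) = N (α * I) := by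
  set c : ℂ := α * I with hc
  have hcS : c ∈ Strip := by
    have := mem_Strip_xy (x := 0) hα
    simpa [hc] using this
  have hnb : Strip ∈ 𝓝 c := isOpen_Strip.mem_nhds hcS
  have hM0 : 0 ≤ M := (norm_nonneg _).trans (hM c hcS)
  let F : ℂ → ℂ := fun z => dslope N c z * (((Real.sin (π * α) : ℝ) : ℂ) / 2) / dslope (Den α) c z
  have dne : ∀ z ∈ Strip, dslope (Den α) c z ≠ 0 := by
    intro z hz
    by_cases hzc : z = c
    · rw [hzc, dslope_same]; exact Den_deriv hα
    · rw [dslope_of_ne _ hzc, slope_def_field, hc, Den_zero, sub_zero]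
      refine div_ne_zero ?_ (sub_ne_zero.2 hzc)
      have e : z = (z.re : ℂ) + (z.im : ℂ) * I := (Complex.re_add_im z).symm
      rw [e]
      apply Den_ne hα ⟨hz.1.le, hz.2.le⟩
      rw [← e]; exact hzc
  have hF : DifferentiableOn ℂ F Strip :=
    (((Complex.differentiableOn_dslope hnb).2 hN).mul_const _).div
      ((Complex.differentiableOn_dslope hnb).2 (Den_diff α).differentiableOn) dne
  have Feq : ∀ z, z ≠ c → F z = (N z - N c) * PoissonC α z := by
    intro z hz
    have h2 : z - c ≠ 0 := sub_ne_zero.2 hz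
    simp only [F, dslope_of_ne _ hz, slope_def_field]
    rw [Poisson_eq]
    have : Den α c = 0 := Den_zero α
    rw [this, sub_zero]
    by_cases hD : Den α z = 0
    · simp [hD]
    · field_simp
  obtain ⟨h0', h1'⟩ := hα
  have hr : 0 < min α (1 - α) / 2 := by
    have := lt_min h0' (sub_pos.2 h1')
    linarith
  have r1 : min α (1 - α) ≤ α := min_le_left _ _
  have r2 : min α (1 - α) ≤ 1 - α := min_le_right _ _
  set r := min α (1 - α) / 2 with hrdef
  have hball : Metric.closedBall c r ⊆ Strip := by
    intro z hz
    rw [Metric.mem_closedBall, dist_eq_norm] at hz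
    have h3 := (Complex.abs_im_le_norm (z - c)).trans hz
    rw [abs_le] at h3
    simp only [hc, sub_im, mul_im, ofReal_re, I_im, mul_one, ofReal_im, I_re, mul_zero, add_zero] at h3
    constructor <;> linarith
  obtain ⟨K, hK⟩ := (isCompact_closedBall c r).exists_bound_of_continuousOn
    (hF.continuousOn.mono hball)
  obtain ⟨C, hC, hCb⟩ := Poisson_bound (α := α) ⟨h0', h1'⟩ hr
  have hK0 : 0 ≤ K := (norm_nonneg _).trans (hK c (Metric.mem_closedBall_self hr.le))
  have hB : ∀ y ∈ Ioo (0:ℝ) 1, ∀ x : ℝ, ‖F (x + y * I)‖ ≤ (2 * M * C + 2 * K) * maj x := by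
    intro y hy x
    have hm := maj_pos x
    by_cases hz : (x + y * I : ℂ) ∈ Metric.closedBall c r
    · have h2 := hK _ hz
      rw [Metric.mem_closedBall, dist_eq_norm] at hz
      have h3 := (Complex.abs_re_le_norm _).trans hz
      rw [abs_le] at h3
      simp [hc] at h3
      have h4 : 1 / 2 ≤ maj x := by
        unfold maj
        rw [one_div]
        apply inv_anti₀ (by positivity)
        nlinarith
      have : 0 ≤ M * C := by positivity
      nlinarith [mul_nonneg this hm.le, mul_le_mul_of_nonneg_left h4 hK0]
    · rw [Metric.mem_closedBall, dist_eq_norm, not_le] at hz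
      have hne : (x + y * I : ℂ) ≠ c := by
        intro h; rw [h, sub_self, norm_zero] at hz; linarith
      rw [Feq _ hne, norm_mul]
      have a1 : ‖N (x + y * I) - N c‖ ≤ 2 * M := by
        have := norm_sub_le (N (x + y * I)) (N c)
        linarith [hM _ (mem_Strip_xy (x := x) hy), hM c hcS]
      have a2 := hCb x y ⟨hy.1.le, hy.2.le⟩ hz.le
      have a3 := mul_le_mul a1 a2 (norm_nonneg _) (by positivity)
      nlinarith [mul_nonneg hK0 hm.le]
  have hB0 := maj_top.const_mul (2 * M * C + 2 * K)
  have hB1 := maj_bot.const_mul (2 * M * C + 2 * K)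
  rw [mul_zero] at hB0 hB1
  have hα : α ∈ Ioo (0:ℝ) 1 := ⟨h0', h1'⟩
  have key := contour hF (maj_int.const_mul (2 * M * C + 2 * K)) hB0 hB1 hB
    (F0 := fun x => (N0 x - N c) * PoissonC α x) (F1 := fun x => (N1 x - N c) * PoissonC α (x + I)) ?_ ?_
  · simp only [sub_mul] at key
    have P0 := Poisson_integrable hα
    have P1 : Integrable (fun x : ℝ => PoissonC α (x + I)) := memLp_one_iff_integrable.1 (Poisson_memLp1 hα 1 le_rfl)
    rw [integral_sub i0 (P0.const_mul _), integral_sub i1 (P1.const_mul _),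
      integral_const_mul, integral_const_mul] at key
    have := Poisson_total hα
    linear_combination key + N c * this
  · intro x
    have hP := (Poisson_contAt (x := x) (y := 0) hα (by simp) hα.1.ne)
    have t : Tendsto (fun y : ℝ => (x + y * I : ℂ)) (𝓝[>] 0) (𝓝 (x + (0:ℝ) * I)) :=
      ((by fun_prop : Continuous (fun y : ℝ => (x + y * I : ℂ))).tendsto 0).mono_left nhdsWithin_le_nhds
    have t2 := hP.tendsto.comp t
    simp only [ofReal_zero, zero_mul, add_zero] at t2
    refine (((h0 x).sub_const (N c)).mul t2).congr' ?_
    filter_upwards [Ioo_mem_nhdsGT hα.1] with y hy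
    rw [Feq]
    · rfl
    · intro h
      have := congrArg Complex.im h
      simp [hc] at this
      exact hy.2.ne this
  · intro x
    have hP := (Poisson_contAt (x := x) (y := 1) hα (by simp) hα.2.ne')
    have t : Tendsto (fun y : ℝ => (x + y * I : ℂ)) (𝓝[<] 1) (𝓝 (x + (1:ℝ) * I)) :=
      ((by fun_prop : Continuous (fun y : ℝ => (x + y * I : ℂ))).tendsto 1).mono_left nhdsWithin_le_nhds
    have t2 := hP.tendsto.comp t
    simp only [ofReal_one, one_mul] at t2
    refine (((h1 x).sub_const (N c)).mul t2).congr' ?_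
    filter_upwards [Ioo_mem_nhdsLT hα.2] with y hy
    rw [Feq]
    · rfl
    · intro h
      have := congrArg Complex.im h
      simp [hc] at this
      exact hy.1.ne' this

lemma ident2 {p q p' q' : ℝ≥0∞} [hpp : p.HolderTriple p' 1] [hqq : q.HolderTriple q' 1]
    {α : ℝ} (hα : α ∈ Ioo (0:ℝ) 1)
    {h W : ℂ → ℂ} {h0 h1 : ℝ → ℂ} (hh : MemHardy p q h)
    (th0 : WT (𝓝[>] 0) h h0) (th1 : WT (𝓝[<] 1) h h1)
    (lh0 : MemLp h0 p volume) (lh1 : MemLp h1 q volume)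
    (hW : Differentiable ℂ W) {C : ℝ} (hb : ∀ x y : ℝ, y ∈ Icc (0:ℝ) 1 → ‖W (x + y * I)‖ ≤ C) :
    (∫ x : ℝ, h0 x * (PoissonC α x * W x)) - ∫ x : ℝ, h1 x * (PoissonC α (x + I) * W (x + I)) =
      h (α * I) * W (α * I) := by
  have hC : 0 ≤ C := (norm_nonneg _).trans (hb 0 0 (by simp))
  have := hpp.symm
  have := hqq.symm
  have hWc := hW.continuous
  have hb0 : ∀ x : ℝ, ‖W x‖ ≤ C := fun x => by simpa using hb x 0 (by simp)
  have hb1 : ∀ x : ℝ, ‖W (x + I)‖ ≤ C := fun x => by simpa using hb x 1 (by simp)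
  have e1 := holder_one_le (p := p) (q := p')
  have e2 := holder_one_le (p := q) (q := q')
  have hcS : (α * I : ℂ) ∈ Strip := by
    have := mem_Strip_xy (x := 0) hα
    simpa using this
  have m0 : MemLp (fun x : ℝ => PoissonC α x * W x) p' volume :=
    memLp_mul_bdd (Poisson_memLp0 hα _ e1.2) (by fun_prop) hb0
  have m1 : MemLp (fun x : ℝ => PoissonC α (x + I) * W (x + I)) q' volume :=
    memLp_mul_bdd (Poisson_memLp1 hα _ e2.2) (by fun_prop) hb1
  have t0 := moll_tendsto e1.1 e1.2 lh0 m0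
  have t1 := moll_tendsto e2.1 e2.2 lh1 m1
  have t2 := (Mo_tendsto_point hh.1 hcS).mul_const (W (α * I))
  refine tendsto_nhds_unique (t0.sub t1) (t2.congr fun a => ?_)
  obtain ⟨M, hM0, hM⟩ := Mo_bound (p' := p') (q' := q') (bmp_cont a) (bmp_supp a) hh
  have i0 : Integrable (fun x : ℝ => (mo (bmp a) h0 x * W x) * PoissonC α x) volume := by
    have hb := fun x => mo_bound (p' := p') (bmp_cont a) (bmp_supp a) lh0 x
    have hm := mo_meas (bmp_cont a) lh0.1
    refine (Poisson_integrable hα).bdd_mul (hm.mul (by fun_prop : Continuous fun x : ℝ => W x).aestronglyMeasurable)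
      (Eventually.of_forall fun x => ?_) (c := ((eLpNorm h0 p volume).toReal * (eLpNorm (fun t => (bmp a t : ℂ)) p' volume).toReal) * C)
    rw [norm_mul]
    exact mul_le_mul (hb x) (hb0 x) (norm_nonneg _) (by positivity)
  have i1 : Integrable (fun x : ℝ => (mo (bmp a) h1 x * W (x + I)) * PoissonC α (x + I)) volume := by
    have hb := fun x => mo_bound (p' := q') (bmp_cont a) (bmp_supp a) lh1 x
    have hm := mo_meas (bmp_cont a) lh1.1
    refine (memLp_one_iff_integrable.1 (Poisson_memLp1 hα 1 le_rfl)).bdd_mul (hm.mul (by fun_prop : Continuous fun x : ℝ => W (x + I)).aestronglyMeasurable)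
      (Eventually.of_forall fun x => ?_) (c := ((eLpNorm h1 q volume).toReal * (eLpNorm (fun t => (bmp a t : ℂ)) q' volume).toReal) * C)
    rw [norm_mul]
    exact mul_le_mul (hb x) (hb1 x) (norm_nonneg _) (by positivity)
  have := resid hα (N := fun z => Mo (bmp a) h z * W z) (M := M * C)
    ((Mo_diff (bmp_cont a) (bmp_supp a) hh.1).mul hW.differentiableOn) ?_
    (N0 := fun x => mo (bmp a) h0 x * W x) (N1 := fun x => mo (bmp a) h1 x * W (x + I)) ?_ ?_ i0 i1
  · rw [← this]
    congr 2
    · ext x; ring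
    · ext x; ring
  · intro z hz
    rw [norm_mul]
    have hz2 := hb z.re z.im ⟨hz.1.le, hz.2.le⟩
    rw [Complex.re_add_im] at hz2
    exact mul_le_mul (hM z hz) hz2 (norm_nonneg _) hM0
  · intro x
    exact (Mo_tendsto (bmp_smooth a) (bmp_supp a) th0 x).mul (lim0 hWc x)
  · intro x
    exact (Mo_tendsto (bmp_smooth a) (bmp_supp a) th1 x).mul (lim1 hWc x)

lemma wt_of_schwartz {l : Filter ℝ} {h : ℂ → ℂ} {v : ℝ → ℂ}
    (H : ∀ φ : SchwartzMap ℝ ℂ,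
      Tendsto (fun y : ℝ => ∫ x : ℝ, h (x + y * Complex.I) * (starRingEnd ℂ) (φ x)) l
        (𝓝 (∫ x : ℝ, v x * (starRingEnd ℂ) (φ x)))) : WT l h v := by
  intro φ hφ hc
  have h1 : ContDiff ℝ ((⊤ : ℕ∞) : WithTop ℕ∞) (fun x => (φ x : ℂ)) :=
    Complex.ofRealCLM.contDiff.comp hφ
  have h2 : HasCompactSupport (fun x => (φ x : ℂ)) := hc.comp_left (g := fun x : ℝ => (x : ℂ)) (by simp)
  have h3 : ∀ x, h2.toSchwartzMap h1 x = (φ x : ℂ) := fun x => rfl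
  have := H (h2.toSchwartzMap h1)
  simpa only [h3, Complex.conj_ofReal] using this

lemma schwartz_neg {l l' : Filter ℝ} {m : ℂ → ℂ} {v : ℝ → ℂ}
    (H : WT l' m v) (hl : Tendsto (fun y : ℝ => -y) l l') :
    WT l (reflect m) (fun x => (starRingEnd ℂ) (v x)) := by
  intro φ hφ hc
  have h1 := (H φ hφ hc).comp hl
  have h2 := (Complex.continuous_conj.tendsto _).comp h1
  rw [← integral_conj] at h2
  simp only [map_mul, Complex.conj_ofReal] at h2
  refine h2.congr fun y => ?_
  simp only [Function.comp]
  rw [← integral_conj]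
  congr 1; ext x
  simp [reflect]

lemma Poisson_conj (α : ℝ) (z : ℂ) :
    (starRingEnd ℂ) (PoissonC α ((starRingEnd ℂ) z)) = PoissonC α z := by
  unfold PoissonC
  have h1 : (π : ℂ) * (starRingEnd ℂ) z = (starRingEnd ℂ) (π * z) := by simp
  rw [h1, Complex.cosh_conj, map_div₀, map_mul, map_sub, Complex.conj_conj, Complex.conj_ofReal,
    Complex.conj_ofReal, Complex.conj_ofNat]

lemma wt_star {α : ℝ} (hα : α ∈ Ioo (0:ℝ) 1) {l : Filter ℝ} [l.IsCountablyGenerated]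
    {e : ℝ} (he : e ∈ Icc (0:ℝ) 1) (hea : e ≠ α) (hle : l ≤ 𝓝 e) (hl : Ioo (0:ℝ) 1 ∈ l) {C : ℝ}
    (hC : ∀ᶠ y : ℝ in l, ∀ x : ℝ, ‖PoissonC α (x + y * I)‖ ≤ C) {m : ℂ → ℂ} {v : ℝ → ℂ}
    {p p' : ℝ≥0∞} [p.HolderTriple p' 1] (hv : MemLp v p volume)
    (hd : DifferentiableOn ℂ (reflect (fun z => m z - PoissonC α z)) Strip)
    (H : WT l (reflect m) (fun x => (starRingEnd ℂ) (v x))) :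
    WT l (reflect (fun z => m z - PoissonC α z))
      (fun x => (starRingEnd ℂ) (v x) - PoissonC α (x + e * I)) := by
  intro φ hφ hc
  have hφc := hφ.continuous
  have hcC : HasCompactSupport (fun x => (φ x : ℂ)) := hc.comp_left (g := fun x : ℝ => (x : ℂ)) (by simp)
  have hφi : Integrable (fun x => (φ x : ℂ)) :=
    (by fun_prop : Continuous (fun x => (φ x : ℂ))).integrable_of_hasCompactSupport hcC
  have hPc : ∀ y ∈ Icc (0:ℝ) 1, y ≠ α → Continuous (fun x : ℝ => PoissonC α (x + y * I)) := by
    intro y hy hne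
    rw [continuous_iff_continuousAt]
    intro x
    exact ContinuousAt.comp (f := fun x : ℝ => (x + y * I : ℂ)) (Poisson_contAt hα hy hne)
      (by fun_prop : Continuous fun x : ℝ => (x + y * I : ℂ)).continuousAt
  have hPi : ∀ y ∈ Icc (0:ℝ) 1, y ≠ α → Integrable (fun x : ℝ => PoissonC α (x + y * I) * (φ x : ℂ)) := by
    intro y hy hne
    have := hPc y hy hne
    exact (by fun_prop : Continuous _).integrable_of_hasCompactSupport hcC.mul_left
  have hne : ∀ᶠ y in l, y ≠ α := hle (isOpen_ne.mem_nhds hea)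
  have tP : Tendsto (fun y : ℝ => ∫ x : ℝ, PoissonC α (x + y * I) * (φ x : ℂ)) l
      (𝓝 (∫ x : ℝ, PoissonC α (x + e * I) * (φ x : ℂ))) := by
    apply tendsto_integral_filter_of_dominated_convergence (fun x => C * ‖(φ x : ℂ)‖)
    · filter_upwards [hl, hne] with y hy hy2
      exact (hPi y ⟨hy.1.le, hy.2.le⟩ hy2).1
    · filter_upwards [hC] with y hy
      refine Eventually.of_forall fun x => ?_
      rw [norm_mul]
      gcongr
      exact hy x
    · exact hφi.norm.const_mul C
    · refine Eventually.of_forall fun x => ?_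
      refine Tendsto.mul_const _ ?_
      have t : Tendsto (fun y : ℝ => (x + y * I : ℂ)) l (𝓝 (x + e * I)) :=
        ((by fun_prop : Continuous (fun y : ℝ => (x + y * I : ℂ))).tendsto e).mono_left hle
      exact (Poisson_contAt (x := x) hα he hea).tendsto.comp t
  have key := (H φ hφ hc).sub tP
  have iv : Integrable (fun x => (starRingEnd ℂ) (v x) * (φ x : ℂ)) :=
    integ_mul (p := p) (q := p') hv.star (memLp_test hφc hc p')
  rw [← integral_sub iv (hPi e he hea)] at key
  simp only [← sub_mul] at key
  refine key.congr' ?_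
  filter_upwards [hl, hne] with y hy hy2
  have eq : ∀ x : ℝ, reflect (fun z => m z - PoissonC α z) (x + y * I) =
      reflect m (x + y * I) - PoissonC α (x + y * I) := by
    intro x
    have := Poisson_conj α (x + y * I)
    unfold reflect
    rw [map_sub, this]
  have hcn : Continuous (fun x : ℝ => reflect (fun z => m z - PoissonC α z) (x + y * I)) :=
    hd.continuousOn.comp_continuous (by fun_prop) (fun x => mem_Strip_xy hy)
  have i2 := hPi y ⟨hy.1.le, hy.2.le⟩ hy2
  have i1 : Integrable (fun x : ℝ => reflect m (x + y * I) * (φ x : ℂ)) := by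
    have i3 : Integrable (fun x : ℝ => reflect (fun z => m z - PoissonC α z) (x + y * I) * (φ x : ℂ)) :=
      (by fun_prop : Continuous _).integrable_of_hasCompactSupport hcC.mul_left
    refine (i3.add i2).congr (Eventually.of_forall fun x => ?_)
    simp only [Pi.add_apply, eq]
    ring
  rw [← integral_sub i1 i2]
  congr 1; ext x
  rw [eq]; ring

/-- primal admissibility -/
def Adm (p q : ℝ≥0∞) (h : ℂ → ℂ) (h0 h1 : ℝ → ℂ) : Prop :=
  MemHardy p q h ∧ WT (𝓝[>] 0) h h0 ∧ WT (𝓝[<] 1) h h1 ∧ MemLp h0 p volume ∧ MemLp h1 q volume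

/-- dual admissibility -/
def AdmS (p q : ℝ≥0∞) (α : ℝ) (m0 m1 : ℝ → ℂ) : Prop :=
  MemLp m0 p volume ∧ MemLp m1 q volume ∧ ∃ n, MemHardy p q n ∧
    WT (𝓝[>] 0) n (fun x => (starRingEnd ℂ) (m0 x) - PoissonC α x) ∧
    WT (𝓝[<] 1) n (fun x => (starRingEnd ℂ) (m1 x) - PoissonC α (x + I))

lemma adm_of {p q : ℝ≥0∞} {h : ℂ → ℂ} {h0 h1 : ℝ → ℂ} (hh : MemHardy p q h) (t0 : IsTrace0 h h0)
    (t1 : IsTrace1 h h1) (l0 : MemLp h0 p volume) (l1 : MemLp h1 q volume) : Adm p q h h0 h1 :=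
  ⟨hh, wt_of_schwartz t0, wt_of_schwartz t1, l0, l1⟩

lemma admS_of {p q p' q' : ℝ≥0∞} [p.HolderTriple p' 1] [q.HolderTriple q' 1] {α : ℝ}
    (hα : α ∈ Ioo (0:ℝ) 1) {m : ℂ → ℂ} {m0 m1 : ℝ → ℂ}
    (hm : MemHardyStar p q (fun z => m z - PoissonC α z)) (t0 : IsTraceStar0 m m0)
    (t1 : IsTraceStarNeg1 m m1) (l0 : MemLp m0 p volume) (l1 : MemLp m1 q volume) :
    AdmS p q α m0 m1 := by
  obtain ⟨C, r, hC, hr, -, -, hr1, b0, b1⟩ := Poisson_bound_low hα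
  have mj : ∀ x, C * maj x ≤ C := fun x => mul_le_of_le_one_right hC (maj_le_one x)
  refine ⟨l0, l1, _, hm, ?_, ?_⟩
  · have := wt_star hα (l := 𝓝[>] (0:ℝ)) (e := 0) (by simp) hα.1.ne nhdsWithin_le_nhds Ioo_mem_0 (C := C)
      (by
        filter_upwards [Ioo_mem_nhdsGT hr] with y hy x
        exact (b0 x y ⟨hy.1.le, hy.2.le⟩).trans (mj x)) (p' := p') l0 hm.1
      (schwartz_neg (l' := 𝓝[<] (0:ℝ)) (wt_of_schwartz t0) (by
        have := tendsto_neg_nhdsGT (a := (0:ℝ))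
        simpa using this))
    simpa using this
  · have := wt_star hα (l := 𝓝[<] (1:ℝ)) (e := 1) (by simp) hα.2.ne' nhdsWithin_le_nhds Ioo_mem_1 (C := C)
      (by
        filter_upwards [Ioo_mem_nhdsLT (show 1 - r < 1 by linarith)] with y hy x
        exact (b1 x y ⟨hy.1.le, hy.2.le⟩).trans (mj x)) (p' := q') l1 hm.1
      (schwartz_neg (l' := 𝓝[>] (-1:ℝ)) (wt_of_schwartz t1) (by
        have := tendsto_neg_nhdsLT (a := (1:ℝ))
        simpa using this))
    simpa using this

lemma core {p q p' q' : ℝ≥0∞} [hpp : p.HolderTriple p' 1] [hqq : q.HolderTriple q' 1]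
    {α : ℝ} (hα : α ∈ Ioo (0:ℝ) 1) {h W : ℂ → ℂ} {h0 h1 m0 m1 : ℝ → ℂ}
    (hh : Adm p q h h0 h1) (hm : AdmS p' q' α m0 m1)
    (hW : Differentiable ℂ W) {C : ℝ} (hb : ∀ x y : ℝ, y ∈ Icc (0:ℝ) 1 → ‖W (x + y * I)‖ ≤ C) :
    (∫ x : ℝ, h0 x * ((starRingEnd ℂ) (m0 x) * W x)) -
      ∫ x : ℝ, h1 x * ((starRingEnd ℂ) (m1 x) * W (x + I)) = h (α * I) * W (α * I) := by
  obtain ⟨H, t0, t1, l0, l1⟩ := hh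
  obtain ⟨k0, k1, n, N, s0, s1⟩ := hm
  have e1 := holder_one_le (p := p) (q := p')
  have e2 := holder_one_le (p := q) (q := q')
  have hWc := hW.continuous
  have hb0 : ∀ x : ℝ, ‖W x‖ ≤ C := fun x => by simpa using hb x 0 (by simp)
  have hb1 : ∀ x : ℝ, ‖W (x + I)‖ ≤ C := fun x => by simpa using hb x 1 (by simp)
  have P0 := Poisson_memLp0 hα p' e1.2
  have P1 := Poisson_memLp1 hα q' e2.2
  have c0 : MemLp (fun x => (starRingEnd ℂ) (m0 x)) p' volume := k0.star
  have c1 : MemLp (fun x => (starRingEnd ℂ) (m1 x)) q' volume := k1.star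
  have I1 := ident1 H N t0 t1 s0 s1 l0 l1 (c0.sub P0) (c1.sub P1) hW hb
  have I2 := ident2 (p' := p') (q' := q') hα H t0 t1 l0 l1 hW hb
  have a0 := integ_mul l0 (memLp_mul_bdd c0 (by fun_prop : Continuous fun x : ℝ => W x) hb0)
  have a1 := integ_mul l1 (memLp_mul_bdd c1 (by fun_prop : Continuous fun x : ℝ => W (x + I)) hb1)
  have a2 := integ_mul l0 (memLp_mul_bdd P0 (by fun_prop : Continuous fun x : ℝ => W x) hb0)
  have a3 := integ_mul l1 (memLp_mul_bdd P1 (by fun_prop : Continuous fun x : ℝ => W (x + I)) hb1)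
  have j0 := integral_sub a0 a2
  have j1 := integral_sub a1 a3
  have x0 : ∀ x : ℝ, h0 x * ((starRingEnd ℂ) (m0 x) * W x) - h0 x * (PoissonC α x * W x) =
    h0 x * ((starRingEnd ℂ) (m0 x) - PoissonC α x) * W x := fun x => by ring
  have x1 : ∀ x : ℝ, h1 x * ((starRingEnd ℂ) (m1 x) * W (x + I)) - h1 x * (PoissonC α (x + I) * W (x + I)) =
    h1 x * ((starRingEnd ℂ) (m1 x) - PoissonC α (x + I)) * W (x + I) := fun x => by ring
  simp only [x0] at j0
  simp only [x1] at j1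
  rw [j0, j1] at I1
  linear_combination I1 + I2

lemma opt_bound {α A B t : ℝ} (hα : α ∈ Ioo (0:ℝ) 1) (hA : 0 ≤ A) (hB : 0 ≤ B)
    (H : ∀ s : ℝ, t ≤ Real.exp (-s * α) * A + Real.exp (s * (1 - α)) * B) :
    t ≤ (A / (1 - α)) ^ (1 - α) * (B / α) ^ α := by
  have h0 := hα.1
  have h1 : 0 < 1 - α := sub_pos.2 hα.2
  rcases hA.eq_or_lt with hA | hA
  · rw [← hA, zero_div, Real.zero_rpow h1.ne', zero_mul]
    have t1 : Tendsto (fun s : ℝ => Real.exp (s * (1 - α)) * B) atBot (𝓝 (0 * B)) :=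
      (Real.tendsto_exp_atBot.comp (tendsto_id.atBot_mul_const h1)).mul_const B
    rw [zero_mul] at t1
    refine ge_of_tendsto t1 (Eventually.of_forall fun s => ?_)
    have := H s
    rw [← hA, mul_zero, zero_add] at this
    exact this
  rcases hB.eq_or_lt with hB | hB
  · rw [← hB, zero_div, Real.zero_rpow h0.ne', mul_zero]
    have t1 : Tendsto (fun s : ℝ => Real.exp (s * α) * A) atBot (𝓝 (0 * A)) :=
      (Real.tendsto_exp_atBot.comp (tendsto_id.atBot_mul_const h0)).mul_const A
    rw [zero_mul] at t1
    refine ge_of_tendsto t1 (Eventually.of_forall fun s => ?_)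
    have := H (-s)
    rw [← hB, mul_zero, add_zero, neg_neg] at this
    exact this
  set a := A / (1 - α) with ha
  set b := B / α with hb
  have ha0 : 0 < a := by positivity
  have hb0 : 0 < b := by positivity
  have eA : A = (1 - α) * a := by rw [ha]; field_simp
  have eB : B = α * b := by rw [hb]; field_simp
  have := H (Real.log a - Real.log b)
  have e1 : Real.exp (-(Real.log a - Real.log b) * α) * a = a ^ (1 - α) * b ^ α := by
    rw [Real.rpow_def_of_pos ha0, Real.rpow_def_of_pos hb0, ← Real.exp_add]
    nth_rewrite 2 [← Real.exp_log ha0]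
    rw [← Real.exp_add]; congr 1; ring
  have e2 : Real.exp ((Real.log a - Real.log b) * (1 - α)) * b = a ^ (1 - α) * b ^ α := by
    rw [Real.rpow_def_of_pos ha0, Real.rpow_def_of_pos hb0, ← Real.exp_add]
    nth_rewrite 2 [← Real.exp_log hb0]
    rw [← Real.exp_add]; congr 1; ring
  rw [eA, eB] at this
  refine this.trans (le_of_eq ?_)
  linear_combination (1 - α) * e1 + α * e2

lemma amgm {α A B : ℝ} (hα : α ∈ Ioo (0:ℝ) 1) (hA : 0 ≤ A) (hB : 0 ≤ B) :
    (A / (1 - α)) ^ (1 - α) * (B / α) ^ α ≤ A + B := by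
  have h0 := hα.1
  have h1 : 0 < 1 - α := sub_pos.2 hα.2
  have := Real.geom_mean_le_arith_mean2_weighted h1.le h0.le (div_nonneg hA h1.le) (div_nonneg hB h0.le)
    (by ring)
  refine this.trans (le_of_eq ?_)
  field_simp

lemma toReal_eLpNorm {r : ℝ≥0∞} (hr0 : r ≠ 0) (hr : r ≠ ⊤) {u : ℝ → ℂ} (hu : MemLp u r volume) :
    (eLpNorm u r volume).toReal = (∫ x, ‖u x‖ ^ r.toReal) ^ (r.toReal⁻¹) := by
  rw [hu.eLpNorm_eq_integral_rpow_norm hr0 hr, ENNReal.toReal_ofReal (by positivity)]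

lemma holder_eq {r s : ℝ≥0∞} [hrs : r.HolderTriple s 1] (hr : r ≠ ⊤) {u v : ℝ → ℂ} (hu : MemLp u r volume)
    (hv : MemLp v s volume) (K : ℝ)
    (H : ∀ᵐ x ∂(volume : Measure ℝ), v x = (K : ℂ) * (u x * ((‖u x‖ ^ (r.toReal - 2) : ℝ) : ℂ))) :
    ∃ J : ℝ, 0 ≤ J ∧ ∫ x, v x * (starRingEnd ℂ) (u x) = ((K * J : ℝ) : ℂ) ∧
      (eLpNorm u r volume).toReal * (eLpNorm v s volume).toReal = |K| * J ∧
      (J = 0 → (eLpNorm u r volume).toReal = 0) := by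
  have h1 := holder_one_le (p := r) (q := s)
  have hr0 : r ≠ 0 := (zero_lt_one.trans_le h1.1).ne'
  have hrr : 1 ≤ r.toReal := by
    have := ENNReal.toReal_mono hr h1.1
    simpa using this
  set ρ := r.toReal with hρ
  set J := ∫ x, ‖u x‖ ^ ρ with hJ
  have hJ0 : 0 ≤ J := integral_nonneg fun x => by positivity
  have eu := toReal_eLpNorm hr0 hr hu
  rw [← hρ, ← hJ] at eu
  have pt : ∀ x, ‖u x‖ ^ (ρ - 2) * ‖u x‖ ^ 2 = ‖u x‖ ^ ρ := by
    intro x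
    rcases (norm_nonneg (u x)).eq_or_lt with h | h
    · rw [← h, Real.zero_rpow (show ρ ≠ 0 by linarith)]; simp
    · rw [← Real.rpow_natCast, ← Real.rpow_add h]; congr 1; push_cast; ring
  have pt1 : ∀ x, u x ≠ 0 → ‖u x‖ * ‖u x‖ ^ (ρ - 2) = ‖u x‖ ^ (ρ - 1) := by
    intro x hx
    have h : 0 < ‖u x‖ := norm_pos_iff.2 hx
    nth_rewrite 1 [← Real.rpow_one ‖u x‖]
    rw [← Real.rpow_add h]; congr 1; ring
  have hint : ∫ x, v x * (starRingEnd ℂ) (u x) = ((K * J : ℝ) : ℂ) := by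
    rw [hJ, ← integral_const_mul, ← integral_complex_ofReal]
    apply integral_congr_ae
    filter_upwards [H] with x hx
    rw [hx, ← pt x]
    have := Complex.mul_conj (u x)
    rw [Complex.normSq_eq_norm_sq] at this
    push_cast at this ⊢
    linear_combination ((K:ℂ) * ((‖u x‖ ^ (ρ - 2) : ℝ) : ℂ)) * this
  have nv : ∀ᵐ x ∂(volume : Measure ℝ), ‖v x‖ = |K| * (‖u x‖ * ‖u x‖ ^ (ρ - 2)) := by
    filter_upwards [H] with x hx
    rw [hx, norm_mul, norm_mul, Complex.norm_real, Complex.norm_real, Real.norm_eq_abs, Real.norm_eq_abs,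
      abs_of_nonneg (a := ‖u x‖ ^ (ρ - 2)) (by positivity)]
  refine ⟨J, hJ0, hint, le_antisymm ?_ ?_, fun h => ?_⟩
  · have hinv := hrs.inv_add_inv_eq_inv
    by_cases hs : s = ⊤
    · have r1 : r = 1 := by
        rw [hs, ENNReal.inv_top, add_zero, inv_one] at hinv
        simpa using hinv
      have ρ1 : ρ = 1 := by rw [hρ, r1]; simp
      rw [eu, ρ1, inv_one, Real.rpow_one, mul_comm]
      gcongr
      apply ENNReal.toReal_le_of_le_ofReal (abs_nonneg _)
      rw [hs, eLpNorm_exponent_top]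
      apply eLpNormEssSup_le_of_ae_bound
      filter_upwards [nv] with x hx
      rw [hx]
      by_cases h0 : u x = 0
      · simp [h0]
      · rw [pt1 x h0, ρ1, sub_self, Real.rpow_zero, mul_one]
    · have hs0 : s ≠ 0 := (zero_lt_one.trans_le h1.2).ne'
      have ev := toReal_eLpNorm hs0 hs hv
      have hss : 1 ≤ s.toReal := by
        have := ENNReal.toReal_mono hs h1.2
        simpa using this
      set σ := s.toReal with hσ
      have hsum : ρ⁻¹ + σ⁻¹ = 1 := by
        have := congrArg ENNReal.toReal hinv
        rw [ENNReal.toReal_add (by simpa using hr0) (by simpa using hs0), ENNReal.toReal_inv, ENNReal.toReal_inv] at this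
        simpa using this
      have hprod : (ρ - 1) * σ = ρ := by
        have : ρ ≠ 0 := by linarith
        have : σ ≠ 0 := by linarith
        field_simp at hsum
        linarith
      have : ∫ x, ‖v x‖ ^ σ = |K| ^ σ * J := by
        rw [hJ, ← integral_const_mul]
        apply integral_congr_ae
        filter_upwards [nv] with x hx
        rw [hx, Real.mul_rpow (abs_nonneg _) (by positivity)]
        congr 1
        by_cases h0 : u x = 0
        · rw [h0, norm_zero, zero_mul, Real.zero_rpow (by linarith), Real.zero_rpow (by linarith)]
        · rw [pt1 x h0, ← Real.rpow_mul (norm_nonneg _), hprod]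
      rw [ev, this, eu, Real.mul_rpow (by positivity) hJ0, ← Real.rpow_mul (abs_nonneg _),
        mul_inv_cancel₀ (by linarith), Real.rpow_one]
      have hJJ : J ^ ρ⁻¹ * J ^ σ⁻¹ = J := by
        rw [← Real.rpow_add' hJ0 (by rw [hsum]; norm_num), hsum, Real.rpow_one]
      apply le_of_eq
      linear_combination |K| * hJJ
  · have := hrs.symm
    have hb := holder_bound hv (hu.star)
    have e2 : ‖∫ x, v x * (star u) x‖ = |K| * J := by
      have : ∫ x, v x * (star u) x = ((K * J : ℝ) : ℂ) := hint
      rw [this, Complex.norm_real, Real.norm_eq_abs, abs_mul, abs_of_nonneg hJ0]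
    rw [e2, eLpNorm_star, mul_comm (eLpNorm v s volume).toReal] at hb
    exact hb
  · rw [eu, h, Real.zero_rpow]
    have : 0 < ρ := by linarith
    positivity

lemma ae_zero_of {p : ℝ≥0∞} (hp : p ≠ 0) {u : ℝ → ℂ} (hu : MemLp u p volume)
    (h : (eLpNorm u p volume).toReal = 0) : u =ᵐ[volume] 0 := by
  rw [ENNReal.toReal_eq_zero_iff] at h
  rcases h with h | h
  · exact (eLpNorm_eq_zero_iff hu.1 hp).1 h
  · exact absurd h hu.2.ne

lemma el_side {p p' : ℝ≥0∞} [hpp : p.HolderTriple p' 1] {h0 m0 : ℝ → ℂ} (lh : MemLp h0 p volume)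
    (lm : MemLp m0 p' volume) {σ K K' : ℝ} (hK : K = σ * |K|) (hK' : K' = σ * |K'|) (hK0 : K ≠ 0)
    (hK0' : K' ≠ 0)
    (H : (p' ≠ ⊤ ∧ ∀ᵐ x ∂(volume : Measure ℝ), h0 x = (K : ℂ) * (m0 x * ((‖m0 x‖ ^ (p'.toReal - 2) : ℝ) : ℂ))) ∨
      (p ≠ ⊤ ∧ ∀ᵐ x ∂(volume : Measure ℝ), m0 x = (K' : ℂ) * (h0 x * ((‖h0 x‖ ^ (p.toReal - 2) : ℝ) : ℂ)))) :
    (∫ x, h0 x * (starRingEnd ℂ) (m0 x) =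
      ((σ * ((eLpNorm h0 p volume).toReal * (eLpNorm m0 p' volume).toReal) : ℝ) : ℂ)) ∧
    ((eLpNorm h0 p volume).toReal * (eLpNorm m0 p' volume).toReal = 0 → m0 =ᵐ[volume] 0) := by
  have h1 := holder_one_le (p := p) (q := p')
  have hp0 : p ≠ 0 := (zero_lt_one.trans_le h1.1).ne'
  have hp0' : p' ≠ 0 := (zero_lt_one.trans_le h1.2).ne'
  have := hpp.symm
  rcases H with ⟨ht, H⟩ | ⟨ht, H⟩
  · obtain ⟨J, hJ, i1, i2, i3⟩ := holder_eq ht lm lh K H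
    rw [mul_comm] at i2
    refine ⟨?_, fun h => ae_zero_of hp0' lm (i3 ?_)⟩
    · rw [i1, i2, ← mul_assoc, ← hK]
    · rw [i2] at h
      exact (mul_eq_zero.1 h).resolve_left (abs_ne_zero.2 hK0)
  · obtain ⟨J, hJ, i1, i2, i3⟩ := holder_eq ht lh lm K' H
    refine ⟨?_, fun h => ?_⟩
    · rw [i2, ← mul_assoc, ← hK', ← Complex.conj_ofReal, ← i1, ← integral_conj]
      congr 1; ext x
      simp [mul_comm]
    · rw [i2] at h
      have := ae_zero_of hp0 lh (i3 ((mul_eq_zero.1 h).resolve_left (abs_ne_zero.2 hK0')))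
      filter_upwards [this, H] with x hx hx2
      rw [hx2, hx]; simp

/-- exponential weight -/
def Wt (α s : ℝ) (z : ℂ) : ℂ := Complex.exp (-(I * s) * (z - α * I))

lemma Wt_diff (α s : ℝ) : Differentiable ℂ (Wt α s) := by unfold Wt; fun_prop

lemma Wt_norm (α s x y : ℝ) : ‖Wt α s (x + y * I)‖ = Real.exp (s * (y - α)) := by
  unfold Wt
  rw [Complex.norm_exp]
  congr 1
  simp

lemma Wt_pt (α s : ℝ) : Wt α s (α * I) = 1 := by simp [Wt]

lemma weighted {p q p' q' : ℝ≥0∞} [hpp : p.HolderTriple p' 1] [hqq : q.HolderTriple q' 1]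
    {α : ℝ} (hα : α ∈ Ioo (0:ℝ) 1) {h : ℂ → ℂ} {h0 h1 m0 m1 : ℝ → ℂ}
    (hh : Adm p q h h0 h1) (hm : AdmS p' q' α m0 m1) (s : ℝ) :
    ‖h (α * I)‖ ≤ Real.exp (-s * α) * ((eLpNorm h0 p volume).toReal * (eLpNorm m0 p' volume).toReal) +
      Real.exp (s * (1 - α)) * ((eLpNorm h1 q volume).toReal * (eLpNorm m1 q' volume).toReal) := by
  have hb : ∀ x y : ℝ, y ∈ Icc (0:ℝ) 1 → ‖Wt α s (x + y * I)‖ ≤ Real.exp |s| := by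
    intro x y hy
    rw [Wt_norm, Real.exp_le_exp]
    have h1 : |y - α| ≤ 1 := abs_le.2 ⟨by linarith [hy.1, hα.2], by linarith [hy.2, hα.1]⟩
    calc s * (y - α) ≤ |s * (y - α)| := le_abs_self _
      _ = |s| * |y - α| := abs_mul _ _
      _ ≤ |s| * 1 := by gcongr
      _ = |s| := mul_one _
  have hc := core hα hh hm (Wt_diff α s) hb
  rw [Wt_pt, mul_one] at hc
  have hWc := (Wt_diff α s).continuous
  obtain ⟨-, -, -, l0, l1⟩ := hh
  obtain ⟨k0, k1, -⟩ := hm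
  have w0 : ∀ x : ℝ, ‖Wt α s x‖ = Real.exp (-s * α) := fun x => by
    have := Wt_norm α s x 0
    simp only [ofReal_zero, zero_mul, add_zero] at this
    rw [this]; congr 1; ring
  have w1 : ∀ x : ℝ, ‖Wt α s (x + I)‖ = Real.exp (s * (1 - α)) := fun x => by
    have := Wt_norm α s x 1
    simp only [ofReal_one, one_mul] at this
    rw [this]
  have side : ∀ (r r' : ℝ≥0∞) [r.HolderTriple r' 1] (u v V : ℝ → ℂ) (D : ℝ), MemLp u r volume →
      MemLp v r' volume → Continuous V → 0 ≤ D → (∀ x, ‖V x‖ = D) →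
      ‖∫ x, u x * ((starRingEnd ℂ) (v x) * V x)‖ ≤
        D * ((eLpNorm u r volume).toReal * (eLpNorm v r' volume).toReal) := by
    intro r r' _ u v V D hu hv hV hD hVD
    have g : MemLp (fun x => (starRingEnd ℂ) (v x) * V x) r' volume :=
      memLp_mul_bdd hv.star hV (fun x => (hVD x).le)
    refine (holder_bound hu g).trans ?_
    have : (eLpNorm (fun x => (starRingEnd ℂ) (v x) * V x) r' volume).toReal ≤
        D * (eLpNorm v r' volume).toReal := by
      have h3 := eLpNorm_le_mul_eLpNorm_of_ae_le_mul (f := fun x => (starRingEnd ℂ) (v x) * V x)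
        (g := v) (c := D) (μ := volume)
        (Eventually.of_forall fun x => by rw [norm_mul, hVD, RCLike.norm_conj, mul_comm]) r'
      have h4 := ENNReal.toReal_mono (ENNReal.mul_ne_top ENNReal.ofReal_ne_top hv.2.ne) h3
      rwa [ENNReal.toReal_mul, ENNReal.toReal_ofReal hD] at h4
    calc _ ≤ (eLpNorm u r volume).toReal * (D * (eLpNorm v r' volume).toReal) := by gcongr
      _ = _ := by ring
  rw [← hc]
  refine (norm_sub_le _ _).trans (add_le_add ?_ ?_)
  · exact side p p' h0 m0 (fun x => Wt α s x) _ l0 k0 (by fun_prop) (Real.exp_pos _).le w0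
  · exact side q q' h1 m1 (fun x => Wt α s (x + I)) _ l1 k1 (by fun_prop) (Real.exp_pos _).le w1

/-- primal normalization -/
def NN (p q : ℝ≥0∞) (α : ℝ) (h0 h1 : ℝ → ℂ) : ℝ :=
  (eLpNorm h0 p volume).toReal ^ (1 - α) * (eLpNorm h1 q volume).toReal ^ α
/-- dual value -/
def DD (p q : ℝ≥0∞) (α : ℝ) (m0 m1 : ℝ → ℂ) : ℝ :=
  ((eLpNorm m0 p volume).toReal / (1 - α)) ^ (1 - α) * ((eLpNorm m1 q volume).toReal / α) ^ α

lemma NN_mul_DD {p q p' q' : ℝ≥0∞} {α : ℝ} (hα : α ∈ Ioo (0:ℝ) 1) (h0 h1 m0 m1 : ℝ → ℂ) :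
    ((eLpNorm h0 p volume).toReal * (eLpNorm m0 p' volume).toReal / (1 - α)) ^ (1 - α) *
      ((eLpNorm h1 q volume).toReal * (eLpNorm m1 q' volume).toReal / α) ^ α =
      NN p q α h0 h1 * DD p' q' α m0 m1 := by
  have h0' := hα.1
  have h1' : 0 < 1 - α := sub_pos.2 hα.2
  unfold NN DD
  rw [mul_div_assoc, mul_div_assoc, Real.mul_rpow (by positivity) (by positivity),
    Real.mul_rpow (by positivity) (by positivity)]
  ring

lemma point_bound {p q p' q' : ℝ≥0∞} [hpp : p.HolderTriple p' 1] [hqq : q.HolderTriple q' 1]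
    {α : ℝ} (hα : α ∈ Ioo (0:ℝ) 1) {h : ℂ → ℂ} {h0 h1 m0 m1 : ℝ → ℂ}
    (hh : Adm p q h h0 h1) (hm : AdmS p' q' α m0 m1) :
    ‖h (α * I)‖ ≤ NN p q α h0 h1 * DD p' q' α m0 m1 := by
  rw [← NN_mul_DD hα]
  exact opt_bound hα (by positivity) (by positivity) (weighted hα hh hm)

lemma adm_transl {p q : ℝ≥0∞} {h : ℂ → ℂ} {h0 h1 : ℝ → ℂ} (hh : Adm p q h h0 h1) (t : ℝ) :
    Adm p q (fun z => h (z + t)) (fun x => h0 (x + t)) (fun x => h1 (x + t)) := by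
  obtain ⟨⟨H, H'⟩, t0, t1, l0, l1⟩ := hh
  have mp := measurePreserving_add_right (volume : Measure ℝ) t
  have wt : ∀ (l : Filter ℝ) (v : ℝ → ℂ), WT l h v → WT l (fun z => h (z + t)) (fun x => v (x + t)) := by
    intro l v hw φ hφ hc
    have := hw (fun x => φ (x - t)) (hφ.comp (contDiff_id.sub contDiff_const))
      (hc.comp_homeomorph (Homeomorph.subRight t))
    rw [← integral_add_right_eq_self _ t] at this
    simp only [add_sub_cancel_right] at this
    refine this.congr fun y => ?_
    rw [← integral_add_right_eq_self _ t]
    congr 1; ext x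
    rw [add_sub_cancel_right]
    congr 2
    push_cast; ring
  refine ⟨⟨?_, ?_⟩, wt _ _ t0, wt _ _ t1, l0.comp_measurePreserving mp, l1.comp_measurePreserving mp⟩
  · refine H.comp (by fun_prop) ?_
    intro z hz
    simpa [Strip] using hz
  · refine lt_of_le_of_lt ?_ H'
    unfold hardyNorm
    refine iSup₂_mono fun y hy => ?_
    refine le_iInf fun f => le_iInf fun g => le_iInf fun hf => le_iInf fun hg => le_iInf fun hfg => ?_
    refine (iInf_le _ (fun x => f (x + t))).trans ((iInf_le _ (fun x => g (x + t))).trans ?_)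
    refine (iInf_le _ (hf.comp (measurable_add_const t))).trans
      ((iInf_le _ (hg.comp (measurable_add_const t))).trans ((iInf_le _ ?_).trans ?_))
    · ext x
      have := congrFun hfg (x + t)
      simp only [Pi.add_apply, bLine] at this ⊢
      rw [this]; congr 1; push_cast; ring
    · have e1 : eLpNorm (fun x => f (x + t)) p volume = eLpNorm f p volume :=
        eLpNorm_comp_measurePreserving hf.aestronglyMeasurable mp
      have e2 : eLpNorm (fun x => g (x + t)) q volume = eLpNorm g q volume :=
        eLpNorm_comp_measurePreserving hg.aestronglyMeasurable mp
      rw [e1, e2]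

lemma line_bound {p q p' q' : ℝ≥0∞} [hpp : p.HolderTriple p' 1] [hqq : q.HolderTriple q' 1]
    {α : ℝ} (hα : α ∈ Ioo (0:ℝ) 1) {h : ℂ → ℂ} {h0 h1 m0 m1 : ℝ → ℂ}
    (hh : Adm p q h h0 h1) (hm : AdmS p' q' α m0 m1) (x : ℝ) :
    ‖bLine h α x‖ ≤ NN p q α h0 h1 * DD p' q' α m0 m1 := by
  have hpb := point_bound hα (adm_transl hh x) hm
  have mp := measurePreserving_add_right (volume : Measure ℝ) x
  have e : NN p q α (fun y => h0 (y + x)) (fun y => h1 (y + x)) = NN p q α h0 h1 := by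
    unfold NN
    have e1 : eLpNorm (fun y => h0 (y + x)) p volume = eLpNorm h0 p volume :=
      eLpNorm_comp_measurePreserving hh.2.2.2.1.1 mp
    have e2 : eLpNorm (fun y => h1 (y + x)) q volume = eLpNorm h1 q volume :=
      eLpNorm_comp_measurePreserving hh.2.2.2.2.1 mp
    rw [e1, e2]
  rw [e] at hpb
  rw [bLine, add_comm (x : ℂ)]
  exact hpb

lemma DD_nonneg {p q : ℝ≥0∞} {α : ℝ} (hα : α ∈ Ioo (0:ℝ) 1) (m0 m1 : ℝ → ℂ) : 0 ≤ DD p q α m0 m1 := by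
  have h0' := hα.1
  have h1' : 0 < 1 - α := sub_pos.2 hα.2
  unfold DD; positivity

lemma NN_nonneg {p q : ℝ≥0∞} {α : ℝ} (m0 m1 : ℝ → ℂ) : 0 ≤ NN p q α m0 m1 := by
  unfold NN; positivity

lemma sup_bound {p q p' q' : ℝ≥0∞} [hpp : p.HolderTriple p' 1] [hqq : q.HolderTriple q' 1]
    {α : ℝ} (hα : α ∈ Ioo (0:ℝ) 1) {h : ℂ → ℂ} {h0 h1 m0 m1 : ℝ → ℂ}
    (hh : Adm p q h h0 h1) (hm : AdmS p' q' α m0 m1) :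
    eLpNorm (bLine h α) ⊤ volume ≤ ENNReal.ofReal (NN p q α h0 h1 * DD p' q' α m0 m1) := by
  rw [eLpNorm_exponent_top]
  exact eLpNormEssSup_le_of_ae_bound (Eventually.of_forall (line_bound hα hh hm))

lemma point_le_sup {p q p' q' : ℝ≥0∞} [hpp : p.HolderTriple p' 1] [hqq : q.HolderTriple q' 1]
    {α : ℝ} (hα : α ∈ Ioo (0:ℝ) 1) {h : ℂ → ℂ} {h0 h1 m0 m1 : ℝ → ℂ}
    (hh : Adm p q h h0 h1) (hm : AdmS p' q' α m0 m1) :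
    ‖h (α * I)‖ ≤ (eLpNorm (bLine h α) ⊤ volume).toReal := by
  have hfin : eLpNorm (bLine h α) ⊤ volume ≠ ⊤ :=
    ((sup_bound hα hh hm).trans_lt ENNReal.ofReal_lt_top).ne
  have hcont : Continuous (bLine h α) :=
    hh.1.1.continuousOn.comp_continuous (by fun_prop) (fun x => mem_Strip_xy hα)
  have hae : ∀ᵐ x ∂(volume : Measure ℝ), ‖bLine h α x‖ ≤ (eLpNorm (bLine h α) ⊤ volume).toReal := by
    filter_upwards [ae_le_eLpNormEssSup (f := bLine h α) (μ := volume)] with x hx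
    rw [← eLpNorm_exponent_top] at hx
    have := ENNReal.toReal_mono hfin hx
    simpa using this
  have hopen : IsOpen {x : ℝ | ¬ ‖bLine h α x‖ ≤ (eLpNorm (bLine h α) ⊤ volume).toReal} := by
    simp only [not_le]
    exact isOpen_lt continuous_const hcont.norm
  have hempty := (hopen.measure_eq_zero_iff volume).1 hae
  by_contra hcon
  have : (0:ℝ) ∈ {x : ℝ | ¬ ‖bLine h α x‖ ≤ (eLpNorm (bLine h α) ⊤ volume).toReal} := by
    simpa [bLine] using hcon
  rw [hempty] at this
  exact this

lemma adm_gauss {p q : ℝ≥0∞} (hp : 1 ≤ p) (hq : 1 ≤ q) :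
    Adm p q (Eg 0) (fun x => Eg 0 x) (fun x => Eg 0 (x + I)) := by
  have hEc := (Eg_diff 0).continuous
  have hb : ∀ x y : ℝ, y ∈ Icc (0:ℝ) 1 → ‖Eg 0 (x + y * I)‖ ≤ Real.exp 1 * maj x := fun x y hy => by
    simpa using Eg_bound 0 (x := x) hy
  have hcy : ∀ y : ℝ, Continuous fun x : ℝ => Eg 0 (x + y * I) := fun y => by fun_prop
  have wt : ∀ (l : Filter ℝ) [l.IsCountablyGenerated] (v : ℝ → ℂ), Ioo (0:ℝ) 1 ∈ l →
      (∀ x : ℝ, Tendsto (fun y : ℝ => Eg 0 (x + y * I)) l (𝓝 (v x))) → WT l (Eg 0) v := by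
    intro l _ v hl ht φ hφ hc
    have hφc := hφ.continuous
    have hφi : Integrable (fun x => (φ x : ℂ)) := memLp_one_iff_integrable.1 (memLp_test hφc hc 1)
    apply tendsto_integral_filter_of_dominated_convergence (fun x => Real.exp 1 * ‖(φ x : ℂ)‖)
    · refine Eventually.of_forall fun y => ?_
      exact ((hcy y).mul (by fun_prop : Continuous fun x => (φ x : ℂ))).aestronglyMeasurable
    · filter_upwards [hl] with y hy
      refine Eventually.of_forall fun x => ?_
      rw [norm_mul]
      gcongr
      exact Eg_bound' 0 ⟨hy.1.le, hy.2.le⟩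
    · exact hφi.norm.const_mul _
    · exact Eventually.of_forall fun x => (ht x).mul_const _
  have b0 : ∀ x : ℝ, ‖Eg 0 (x : ℂ)‖ ≤ Real.exp 1 * maj x := fun x => by
    have := hb x 0 (by simp)
    rwa [ofReal_zero, zero_mul, add_zero] at this
  have b1 : ∀ x : ℝ, ‖Eg 0 (x + I)‖ ≤ Real.exp 1 * maj x := fun x => by
    have := hb x 1 (by simp)
    rwa [ofReal_one, one_mul] at this
  have c0 : Continuous fun x : ℝ => Eg 0 (x : ℂ) := hEc.comp continuous_ofReal
  have c1 : Continuous fun x : ℝ => Eg 0 (x + I) :=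
    hEc.comp (continuous_ofReal.add continuous_const)
  have l0 := memLp_maj c0.aestronglyMeasurable b0 p hp
  have l1 := memLp_maj c1.aestronglyMeasurable b1 q hq
  have w0 := wt (𝓝[>] 0) (fun x => Eg 0 x) Ioo_mem_0 (lim0 hEc)
  have w1 := wt (𝓝[<] 1) (fun x => Eg 0 (x + I)) Ioo_mem_1 (lim1 hEc)
  refine ⟨⟨(Eg_diff 0).differentiableOn, ?_⟩, w0, w1, l0, l1⟩
  set G : ℝ → ℂ := fun x => ((Real.exp 1 * maj x : ℝ) : ℂ) with hG
  have hmc := maj_cont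
  have hGm : ∀ r : ℝ≥0∞, 1 ≤ r → MemLp G r volume := fun r hr =>
    memLp_maj (C := Real.exp 1) (by fun_prop : Continuous G).aestronglyMeasurable
      (fun x => by
        have := maj_pos x
        rw [hG, Complex.norm_real, Real.norm_of_nonneg (by positivity)]) r hr
  refine lt_of_le_of_lt (b := eLpNorm G p volume + eLpNorm G q volume) ?_
    (ENNReal.add_lt_top.2 ⟨(hGm p hp).2, (hGm q hq).2⟩)
  unfold hardyNorm
  refine iSup₂_le fun y hy => ?_
  have hy1 : 0 < 1 - y := sub_pos.2 hy.2
  refine (iInf_le _ (fun x : ℝ => ((1 - y : ℝ) : ℂ) * Eg 0 (x + y * I))).trans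
    ((iInf_le _ (fun x : ℝ => ((y : ℝ) : ℂ) * Eg 0 (x + y * I))).trans ?_)
  have hc1 := hcy y
  refine (iInf_le _ (by fun_prop : Continuous _).measurable).trans
      ((iInf_le _ (by fun_prop : Continuous _).measurable).trans ((iInf_le _ ?_).trans ?_))
  · ext x
    simp only [Pi.add_apply, bLine]
    push_cast; ring
  · have gen : ∀ (r : ℝ≥0∞) (a : ℝ), 0 < a →
        ENNReal.ofReal a⁻¹ * eLpNorm (fun x : ℝ => ((a : ℝ) : ℂ) * Eg 0 (x + y * I)) r volume ≤
          eLpNorm G r volume := by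
      intro r a ha
      have h3 := eLpNorm_le_mul_eLpNorm_of_ae_le_mul (f := fun x : ℝ => ((a : ℝ) : ℂ) * Eg 0 (x + y * I))
        (g := G) (c := a) (μ := volume)
        (Eventually.of_forall fun x => by
          have := maj_pos x
          rw [norm_mul, hG, Complex.norm_real, Complex.norm_real, Real.norm_of_nonneg ha.le,
            Real.norm_of_nonneg (by positivity)]
          gcongr
          exact hb x y ⟨hy.1.le, hy.2.le⟩) r
      calc _ ≤ ENNReal.ofReal a⁻¹ * (ENNReal.ofReal a * eLpNorm G r volume) := by gcongr
        _ = eLpNorm G r volume := by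
          rw [← mul_assoc, ← ENNReal.ofReal_mul (by positivity), inv_mul_cancel₀ ha.ne',
            ENNReal.ofReal_one, one_mul]
    exact add_le_add (gen p _ hy1) (gen q _ hy.1)

/-- **Euler-Lagrange equations** (Lemma 4.1): solutions of the Euler-Lagrange equations
are optimizers of the primal and dual problems. -/
theorem euler_lagrange (α : ℝ) (hα : α ∈ Set.Ioo (0:ℝ) 1) (p q pst qst : ℝ≥0∞)
    (hp : 1 ≤ p) (hq : 1 ≤ q) (hpc : p⁻¹ + pst⁻¹ = 1) (hqc : q⁻¹ + qst⁻¹ = 1)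
    (h m : ℂ → ℂ) (h0 h1 m0 m1 : ℝ → ℂ) (c : ℝ) (hc : 0 < c)
    (hh : MemHardy p q h) (hht0 : IsTrace0 h h0) (hht1 : IsTrace1 h h1)
    (hh0 : MemLp h0 p volume) (hh1 : MemLp h1 q volume)
    (hm : MemHardyStar pst qst (fun z => m z - PoissonC α z))
    (hmt0 : IsTraceStar0 m m0) (hmt1 : IsTraceStarNeg1 m m1)
    (hm0 : MemLp m0 pst volume) (hm1 : MemLp m1 qst volume)
    (hel0 : (pst ≠ ⊤ ∧ ∀ᵐ x ∂(volume : Measure ℝ),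
        h0 x = m0 x * ((‖m0 x‖ ^ (pst.toReal - 2) : ℝ) : ℂ)) ∨
      (p ≠ ⊤ ∧ ∀ᵐ x ∂(volume : Measure ℝ),
        m0 x = h0 x * ((‖h0 x‖ ^ (p.toReal - 2) : ℝ) : ℂ)))
    (hel1 : (qst ≠ ⊤ ∧ ∀ᵐ x ∂(volume : Measure ℝ),
        h1 x = -((c : ℂ)) * (m1 x * ((‖m1 x‖ ^ (qst.toReal - 2) : ℝ) : ℂ))) ∨
      (q ≠ ⊤ ∧ ∀ᵐ x ∂(volume : Measure ℝ),
        m1 x = -(((c ^ (1 - q.toReal) : ℝ)) : ℂ) * (h1 x * ((‖h1 x‖ ^ (q.toReal - 2) : ℝ) : ℂ)))) :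
    (eLpNorm (bLine h α) ⊤ volume).toReal /
        ((eLpNorm h0 p volume).toReal ^ (1 - α) * (eLpNorm h1 q volume).toReal ^ α) =
      Hval p q α ∧
    IsLeast (dualSet pst qst α)
      (((eLpNorm m0 pst volume).toReal / (1 - α)) ^ (1 - α) *
        ((eLpNorm m1 qst volume).toReal / α) ^ α) := by
  have HT0 : p.HolderTriple pst 1 := ⟨by rw [hpc, inv_one]⟩
  have HT1 : q.HolderTriple qst 1 := ⟨by rw [hqc, inv_one]⟩
  have HS0 := HT0.symm
  have HS1 := HT1.symm
  have ah : Adm p q h h0 h1 := adm_of hh hht0 hht1 hh0 hh1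
  have am : AdmS pst qst α m0 m1 := admS_of (p' := p) (q' := q) hα hm hmt0 hmt1 hm0 hm1
  obtain ⟨i0, z0⟩ := el_side hh0 hm0 (σ := 1) (K := 1) (K' := 1) (by simp) (by simp) one_ne_zero
    one_ne_zero (by simpa using hel0)
  have hcq : 0 < c ^ (1 - q.toReal) := Real.rpow_pos_of_pos hc _
  obtain ⟨i1, z1⟩ := el_side hh1 hm1 (σ := -1) (K := -c) (K' := -c ^ (1 - q.toReal))
    (by rw [abs_neg, abs_of_pos hc]; ring) (by rw [abs_neg, abs_of_pos hcq]; ring)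
    (neg_ne_zero.2 hc.ne') (neg_ne_zero.2 hcq.ne') (by
      rw [Complex.ofReal_neg, Complex.ofReal_neg]
      exact hel1)
  have key : ∀ (k : ℂ → ℂ) (k0 k1 : ℝ → ℂ), Adm p q k k0 k1 →
      (∫ x : ℝ, k0 x * (starRingEnd ℂ) (m0 x)) - ∫ x : ℝ, k1 x * (starRingEnd ℂ) (m1 x) = k (α * I) := by
    intro k k0 k1 hk
    have := core hα hk am (W := fun _ => 1) (differentiable_const _) (C := 1) (fun x y _ => by simp)
    simpa using this
  set A := (eLpNorm h0 p volume).toReal * (eLpNorm m0 pst volume).toReal with hA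
  set B := (eLpNorm h1 q volume).toReal * (eLpNorm m1 qst volume).toReal with hB
  have hA0 : 0 ≤ A := by positivity
  have hB0 : 0 ≤ B := by positivity
  have hval : h (α * I) = ((A + B : ℝ) : ℂ) := by
    rw [← key h h0 h1 ah, i0, i1]
    push_cast; ring
  have hnorm : ‖h (α * I)‖ = A + B := by
    rw [hval, Complex.norm_real, Real.norm_of_nonneg (by positivity)]
  have hle : ‖h (α * I)‖ ≤ NN p q α h0 h1 * DD pst qst α m0 m1 := point_bound hα ah am
  have hge : NN p q α h0 h1 * DD pst qst α m0 m1 ≤ A + B := by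
    rw [← NN_mul_DD hα]
    exact amgm hα hA0 hB0
  have heq : NN p q α h0 h1 * DD pst qst α m0 m1 = A + B := le_antisymm hge (hnorm ▸ hle)
  have hpos : 0 < A + B := by
    rcases (add_nonneg hA0 hB0).eq_or_lt with hz | hz
    · exfalso
      have a0 := z0 (by linarith)
      have a1 := z1 (by linarith)
      have g := key _ _ _ (adm_gauss hp hq)
      rw [integral_eq_zero_of_ae, integral_eq_zero_of_ae] at g
      · rw [sub_zero] at g
        exact Complex.exp_ne_zero _ g.symm
      · filter_upwards [a1] with x hx
        simp [hx]
      · filter_upwards [a0] with x hx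
        simp [hx]
    · exact hz
  have hD0 : 0 ≤ DD pst qst α m0 m1 := DD_nonneg hα m0 m1
  have hNpos : 0 < NN p q α h0 h1 := by
    rcases (NN_nonneg (p := p) (q := q) (α := α) h0 h1).eq_or_lt with hz | hz
    · rw [← hz, zero_mul] at heq; linarith
    · exact hz
  have hsup : (eLpNorm (bLine h α) ⊤ volume).toReal = A + B := by
    apply le_antisymm
    · rw [← heq]
      exact ENNReal.toReal_le_of_le_ofReal (by positivity) (sup_bound hα ah am)
    · rw [← hnorm]; exact point_le_sup hα ah am
  have hratio : (eLpNorm (bLine h α) ⊤ volume).toReal / NN p q α h0 h1 = DD pst qst α m0 m1 := by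
    rw [hsup, ← heq]; field_simp
  have hgreat : IsGreatest (ratioSet p q α) (DD pst qst α m0 m1) := by
    constructor
    · refine ⟨h, h0, h1, hh, ⟨α * I, ?_, ?_⟩, hht0, hht1, hh0, hh1, hratio.symm⟩
      · have := mem_Strip_xy (x := 0) hα
        simpa using this
      · rw [← norm_pos_iff, hnorm]; exact hpos
    · rintro r ⟨k, k0, k1, hk, -, s0, s1, l0, l1, rfl⟩
      have ak : Adm p q k k0 k1 := adm_of hk s0 s1 l0 l1
      refine div_le_of_le_mul₀ (NN_nonneg (p := p) (q := q) (α := α) k0 k1) hD0 ?_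
      have hn := NN_nonneg (p := p) (q := q) (α := α) k0 k1
      have := ENNReal.toReal_le_of_le_ofReal (by positivity) (sup_bound hα ak am)
      rw [mul_comm]
      exact this
  refine ⟨?_, ?_, ?_⟩
  · rw [Hval, hgreat.csSup_eq]
    exact hratio
  · exact ⟨m, m0, m1, hm, hmt0, hmt1, hm0, hm1, rfl⟩
  · rintro r ⟨m', k0, k1, hm', s0, s1, l0, l1, rfl⟩
    have am' : AdmS pst qst α k0 k1 := admS_of (p' := p) (q' := q) hα hm' s0 s1 l0 l1
    have hle' : ‖h (α * I)‖ ≤ NN p q α h0 h1 * DD pst qst α k0 k1 := point_bound hα ah am'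
    rw [hnorm, ← heq] at hle'
    exact le_of_mul_le_mul_left hle' hNpos
end
end

section
/- Let ν₀, ν₁ be finite complex Borel measures on ℝ and f₀, f₁ ∈ L^∞(ℝ), and regard μ₀ := ν₀ + f₀ and μ₁ := ν₁ + f₁ as tempered distributions on ℝ. Suppose that ∫_ℝ (𝓕φ) dμ₁ = ∫_ℝ 𝓕(k ↦ e^{k} φ(k)) dμ₀ for every compactly supported smooth φ : ℝ → ℂ (i.e. the Fourier transforms satisfy μ̂₁ = e^{·} · μ̂₀ in the tempered distribution sense). Then μ₀ and μ₁ belong to L¹(ℝ) + L^∞(ℝ); that is, there exist g₀, g₁ ∈ L¹(ℝ) and b₀, b₁ ∈ L^∞(ℝ) such that μ₀ = g₀ + b₀ and μ₁ = g₁ + b₁ as tempered distributions. In particular, the measures ν₀ and ν₁ are absolutely continuous with respect to Lebesgue measure whenever f₀ = f₁ = 0. -/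
open MeasureTheory Complex Filter Set
open scoped Real ENNReal Topology

noncomputable section

/-- Fourier transform with the convention `f̂(k) = ∫ f(x) e^{-ikx} dx`. -/
def fInt (φ : ℝ → ℂ) (x : ℝ) : ℂ := ∫ k : ℝ, φ k * Complex.exp (-(Complex.I * k * x))

section Helpers

/-- Vanishing of all the nonnegative frequencies of the complex measure `w dm` on the upper half plane. -/
def Annih {X : Type*} [MeasurableSpace X] (m : Measure X) (z : X → ℂ) (w : X → ℂ) : Prop :=
  Integrable w m ∧ ∀ a : ℝ, 0 ≤ a → ∫ x, Complex.exp (I * a * z x) * w x ∂m = 0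

def resol (c r : ℝ) (z : ℂ) : ℂ := I / (z - c + r * I)

lemma resol_ne {c r : ℝ} (hr : 0 < r) {z : ℂ} (hz : 0 ≤ z.im) : z - c + r * I ≠ 0 := by
  intro h
  have := congrArg Complex.im h
  simp at this
  linarith

lemma resol_re {c r : ℝ} (z : ℂ) :
    (resol c r z).re = (z.im + r) / Complex.normSq (z - c + r * I) := by
  simp [resol, Complex.div_re]

lemma resol_re_nonneg {c r : ℝ} (hr : 0 < r) {z : ℂ} (hz : 0 ≤ z.im) : 0 ≤ (resol c r z).re := by
  rw [resol_re]
  have := Complex.normSq_nonneg (z - c + r * I)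
  positivity

lemma resol_norm {c r : ℝ} (z : ℂ) : ‖resol c r z‖ = 1 / ‖z - c + r * I‖ := by
  simp [resol]

lemma resol_norm_le {c r : ℝ} (hr : 0 < r) {z : ℂ} (hz : 0 ≤ z.im) : ‖resol c r z‖ ≤ 1 / r := by
  rw [resol_norm]
  apply one_div_le_one_div_of_le hr
  have := Complex.abs_im_le_norm (z - c + r * I)
  simp at this
  rw [abs_of_nonneg (by positivity)] at this
  linarith

lemma resol_meas (c r : ℝ) : Measurable (resol c r) := by
  unfold resol
  fun_prop

lemma resol_eq {c r : ℝ} (hr : 0 < r) {z : ℂ} (hz : 0 ≤ z.im) :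
    ∫ s : ℝ in Ioi 0, Complex.exp (I * (z - c + r * I) * s) = resol c r z := by
  rw [integral_exp_mul_complex_Ioi]
  · have := resol_ne (c := c) hr hz
    simp only [ofReal_zero, mul_zero, Complex.exp_zero, resol]
    field_simp
    simp [neg_div]
  · simp; linarith

variable {X : Type*} [MeasurableSpace X] {m : Measure X} {z : X → ℂ}

lemma norm_exp_le {a : ℝ} (ha : 0 ≤ a) {z : ℂ} (hz : 0 ≤ z.im) : ‖Complex.exp (I * a * z)‖ ≤ 1 := by
  rw [Complex.norm_exp]
  simp
  positivity

lemma Annih.bdd_int {w : X → ℂ} (hw : Integrable w m) {g : X → ℂ} (hg : AEStronglyMeasurable g m)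
    {C : ℝ} (hC : ∀ x, ‖g x‖ ≤ C) : Integrable (fun x => g x * w x) m :=
  hw.bdd_mul (c := C) hg (Eventually.of_forall hC)

lemma Annih.exp_int {w : X → ℂ} (hw : Integrable w m) (hzm : Measurable z) (hz : ∀ x, 0 ≤ (z x).im)
    {a : ℝ} (ha : 0 ≤ a) : Integrable (fun x => Complex.exp (I * a * z x) * w x) m :=
  Annih.bdd_int hw (by fun_prop) (fun x => norm_exp_le ha (hz x))

lemma Annih.resol [SFinite m] {w : X → ℂ} (h : Annih m z w) (hzm : Measurable z)
    (hz : ∀ x, 0 ≤ (z x).im) {c r : ℝ} (hr : 0 < r) :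
    Annih m z (fun x => resol c r (z x) * w x) := by
  refine ⟨Annih.bdd_int h.1 ((resol_meas c r).comp hzm).aestronglyMeasurable
    (fun x => resol_norm_le hr (hz x)), fun a ha => ?_⟩
  have hre : ∀ x, Complex.exp (I * a * z x) * (_root_.resol c r (z x) * w x)
      = ∫ s : ℝ in Ioi 0, Complex.exp (I * (z x - c + r * I) * s) *
        (Complex.exp (I * a * z x) * w x) := by
    intro x
    rw [integral_mul_const, resol_eq hr (hz x)]
    ring
  simp_rw [hre]
  rw [integral_integral_swap]
  · rw [setIntegral_congr_fun (g := fun _ => 0) measurableSet_Ioi]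
    · simp
    · intro s hs
      have h1 := h.2 (a + s) (by simp at hs; linarith)
      have : ∀ x, Complex.exp (I * (z x - c + r * I) * s) * (Complex.exp (I * a * z x) * w x)
          = Complex.exp (I * (- c + r * I) * s) * (Complex.exp (I * (a + s : ℝ) * z x) * w x) := by
        intro x
        rw [← mul_assoc, ← mul_assoc, ← Complex.exp_add, ← Complex.exp_add]
        congr 2
        push_cast
        ring
      simp_rw [this, integral_const_mul, h1, mul_zero]
  · have h2 : Integrable (fun s : ℝ => Real.exp (-r * s)) (volume.restrict (Ioi 0)) :=
      integrableOn_exp_mul_Ioi (by linarith) 0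
    have h3 := (Annih.exp_int h.1 hzm hz ha).norm.mul_prod h2
    refine h3.mono' ?_ ?_
    · apply AEStronglyMeasurable.mul
      · apply Measurable.aestronglyMeasurable
        fun_prop
      · exact (Annih.exp_int h.1 hzm hz ha).1.comp_fst
    · have : ∀ᵐ p ∂(m.prod (volume.restrict (Ioi (0:ℝ)))), p.2 ∈ Ioi (0:ℝ) :=
        Measure.quasiMeasurePreserving_snd.ae (ae_restrict_mem measurableSet_Ioi)
      filter_upwards [this] with p hp
      simp only [Function.uncurry, norm_mul]
      rw [mul_comm]
      gcongr
      rw [Complex.norm_exp]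
      simp
      have := hz p.1
      simp at hp
      nlinarith [mul_nonneg this hp.le]

lemma Annih.add {w w' : X → ℂ} (h : Annih m z w) (h' : Annih m z w') (hzm : Measurable z)
    (hz : ∀ x, 0 ≤ (z x).im) : Annih m z (fun x => w x + w' x) := by
  refine ⟨h.1.add h'.1, fun a ha => ?_⟩
  simp_rw [mul_add]
  rw [integral_add (Annih.exp_int h.1 hzm hz ha) (Annih.exp_int h'.1 hzm hz ha), h.2 a ha, h'.2 a ha,
    add_zero]

lemma Annih.const_mul {w : X → ℂ} (h : Annih m z w) (k : ℂ) : Annih m z (fun x => k * w x) := by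
  refine ⟨h.1.const_mul k, fun a ha => ?_⟩
  simp_rw [mul_left_comm _ k, integral_const_mul, h.2 a ha, mul_zero]

def HH (t : Finset ℝ) (r : ℝ → ℝ) (M : ℝ) (z : ℂ) : ℂ := ∑ c ∈ t, (M * r c : ℝ) * resol c (r c) z

lemma HH_meas (t : Finset ℝ) (r : ℝ → ℝ) (M : ℝ) : Measurable (HH t r M) := by
  unfold HH
  have := resol_meas
  fun_prop

lemma HH_norm_le {t : Finset ℝ} {r : ℝ → ℝ} {M : ℝ} (hM : 0 ≤ M) (hr : ∀ c ∈ t, 0 < r c) {z : ℂ}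
    (hz : 0 ≤ z.im) : ‖HH t r M z‖ ≤ M * t.card := by
  unfold HH
  refine (norm_sum_le _ _).trans ?_
  have : ∀ c ∈ t, ‖((M * r c : ℝ) : ℂ) * resol c (r c) z‖ ≤ M := by
    intro c hc
    have h1 := resol_norm_le (c := c) (hr c hc) hz
    have h2 := hr c hc
    rw [norm_mul, Complex.norm_real, Real.norm_eq_abs, abs_of_nonneg (by positivity)]
    calc M * r c * ‖resol c (r c) z‖ ≤ M * r c * (1 / r c) := by gcongr
      _ = M := by field_simp
  refine (Finset.sum_le_sum this).trans ?_
  simp [mul_comm]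

lemma Annih.HH [SFinite m] {w : X → ℂ} (h : Annih m z w) (hzm : Measurable z)
    (hz : ∀ x, 0 ≤ (z x).im) {t : Finset ℝ} {r : ℝ → ℝ} {M : ℝ} (hr : ∀ c ∈ t, 0 < r c) :
    Annih m z (fun x => HH t r M (z x) * w x) := by
  unfold _root_.HH
  induction t using Finset.induction_on with
  | empty => simpa using h.const_mul 0
  | insert c t hc ih =>
    simp only [Finset.sum_insert hc, add_mul, mul_assoc]
    apply Annih.add _ _ hzm hz
    · exact (h.resol hzm hz (hr c (by simp))).const_mul _
    · simpa only [mul_assoc] using ih (fun c hc => hr c (by simp [hc]))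

lemma Annih.HHpow [SFinite m] {w : X → ℂ} (h : Annih m z w) (hzm : Measurable z)
    (hz : ∀ x, 0 ≤ (z x).im) {t : Finset ℝ} {r : ℝ → ℝ} {M : ℝ} (hr : ∀ c ∈ t, 0 < r c) (n : ℕ) :
    Annih m z (fun x => (_root_.HH t r M (z x)) ^ n * w x) := by
  induction n with
  | zero => simpa using h
  | succ n ih => simpa only [pow_succ', mul_assoc] using ih.HH hzm hz (M := M) hr

lemma Annih.exp_HH [SFinite m] {w : X → ℂ} (h : Annih m z w) (hzm : Measurable z)
    (hz : ∀ x, 0 ≤ (z x).im) {t : Finset ℝ} {r : ℝ → ℝ} {M : ℝ} (hM : 0 ≤ M)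
    (hr : ∀ c ∈ t, 0 < r c) :
    ∫ x, Complex.exp (-_root_.HH t r M (z x)) * w x ∂m = 0 := by
  set B : ℝ := M * t.card
  have hB : ∀ x, ‖_root_.HH t r M (z x)‖ ≤ B := fun x => HH_norm_le hM hr (hz x)
  have key := hasSum_integral_of_dominated_convergence (μ := m)
    (F := fun (n : ℕ) x => ((-_root_.HH t r M (z x)) ^ n / (n.factorial : ℂ)) * w x)
    (f := fun x => Complex.exp (-_root_.HH t r M (z x)) * w x)
    (fun n x => B ^ n / (n.factorial : ℝ) * ‖w x‖) ?_ ?_ ?_ ?_ ?_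
  · have h0 : ∀ n : ℕ, ∫ x, ((-_root_.HH t r M (z x)) ^ n / (n.factorial : ℂ)) * w x ∂m = 0 := by
      intro n
      have h1 := ((h.HHpow hzm hz (M := M) hr n).const_mul ((-1) ^ n / (n.factorial : ℂ))).2 0 le_rfl
      rw [← h1]
      congr 1 with x
      simp
      rw [neg_pow]
      ring
    simp_rw [h0] at key
    exact key.unique hasSum_zero
  · intro n
    refine AEStronglyMeasurable.mul ?_ h.1.1
    apply Measurable.aestronglyMeasurable
    have := (HH_meas t r M).comp hzm
    exact (this.neg.pow_const n).div_const _
  · intro n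
    refine Eventually.of_forall fun x => ?_
    simp only [norm_mul, norm_div, norm_pow, norm_neg, Complex.norm_natCast]
    gcongr
    exact hB x
  · exact Eventually.of_forall fun x => (Real.summable_pow_div_factorial B).mul_right _
  · simp_rw [tsum_mul_right]
    exact h.1.norm.const_mul _
  · refine Eventually.of_forall fun x => ?_
    apply HasSum.mul_right
    rw [Complex.exp_eq_exp_ℂ]
    exact NormedSpace.expSeries_div_hasSum_exp _

lemma cover_null {E : Set ℝ} (hE : IsCompact E) (hE0 : volume E = 0) {ε : ℝ} (hε : 0 < ε) :
    ∃ (t : Finset ℝ) (r : ℝ → ℝ), (∀ c ∈ t, c ∈ E ∧ 0 < r c) ∧ (∑ c ∈ t, r c ≤ ε) ∧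
      ∀ x ∈ E, ∃ c ∈ t, |x - c| ≤ r c := by
  obtain ⟨U, hEU, hUo, hU⟩ := E.exists_isOpen_lt_of_lt (μ := volume) (ENNReal.ofReal (ε / 2))
    (by rw [hE0]; simpa using hε)
  have h1 : ∀ x ∈ E, ∃ r, 0 < r ∧ Metric.closedBall x r ⊆ U := by
    intro x hx
    exact Metric.nhds_basis_closedBall.mem_iff.1 (hUo.mem_nhds (hEU hx))
  choose! r hr0 hrU using h1
  obtain ⟨s, hsE, hs⟩ := hE.elim_nhds_subcover (fun x => Metric.closedBall x (r x))
    (fun x hx => Metric.closedBall_mem_nhds x (hr0 x hx))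
  obtain ⟨u, hus, hud, hu⟩ := Vitali.exists_disjoint_subfamily_covering_enlargement_closedBall
    (s : Set ℝ) (fun x => x) r (∑ x ∈ s, r x)
    (fun a ha => Finset.single_le_sum (fun i hi => (hr0 i (hsE i hi)).le) ha) 4 (by norm_num)
  have huf : u.Finite := s.finite_toSet.subset hus
  have huE : ∀ c ∈ u, c ∈ E := fun c hc => hsE c (hus hc)
  refine ⟨huf.toFinset, fun x => 4 * r x, ?_, ?_, ?_⟩
  · intro c hc
    have hc := huE c (by simpa using hc)
    exact ⟨hc, by have := hr0 c hc; positivity⟩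
  · have h2 : volume (⋃ c ∈ huf.toFinset, Metric.closedBall c (r c)) ≤ ENNReal.ofReal (ε / 2) := by
      refine (measure_mono ?_).trans hU.le
      refine iUnion₂_subset fun c hc => hrU c (huE c (by simpa using hc))
    rw [measure_biUnion_finset] at h2
    · simp only [Real.volume_closedBall] at h2
      rw [← ENNReal.ofReal_sum_of_nonneg, ENNReal.ofReal_le_ofReal_iff (by positivity)] at h2
      · rw [← Finset.mul_sum] at h2 ⊢
        linarith
      · intro c hc
        have := hr0 c (huE c (by simpa using hc))
        positivity
    · simpa using hud
    · intro c _
      exact Metric.isClosed_closedBall.measurableSet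
  · intro x hx
    obtain ⟨y, hy, hxy⟩ := mem_iUnion₂.1 (hs hx)
    obtain ⟨c, hc, hyc⟩ := hu y hy
    refine ⟨c, by simpa using hc, ?_⟩
    have := hyc hxy
    simpa [Real.dist_eq] using this

lemma HH_re_nonneg {t : Finset ℝ} {r : ℝ → ℝ} {M : ℝ} (hM : 0 ≤ M) (hr : ∀ c ∈ t, 0 < r c) {z : ℂ}
    (hz : 0 ≤ z.im) : 0 ≤ (HH t r M z).re := by
  unfold HH
  rw [Complex.re_sum]
  refine Finset.sum_nonneg fun c hc => ?_
  rw [Complex.re_ofReal_mul]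
  have := resol_re_nonneg (c := c) (hr c hc) hz
  have := hr c hc
  positivity

lemma HH_re_ge {t : Finset ℝ} {r : ℝ → ℝ} {M : ℝ} (hM : 0 ≤ M) (hr : ∀ c ∈ t, 0 < r c) {x : ℝ}
    (hx : ∃ c ∈ t, |x - c| ≤ r c) : M / 2 ≤ (HH t r M x).re := by
  obtain ⟨c, hc, hxc⟩ := hx
  unfold HH
  rw [Complex.re_sum]
  have h1 := Finset.single_le_sum (f := fun c => (((M * r c : ℝ) : ℂ) * resol c (r c) x).re) (s := t)
    (fun c hc => by
      rw [Complex.re_ofReal_mul]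
      have := resol_re_nonneg (c := c) (z := x) (hr c hc) (by simp)
      have := hr c hc
      positivity) hc
  refine le_trans ?_ h1
  rw [Complex.re_ofReal_mul, resol_re]
  have h0 := hr c hc
  have h2 : Complex.normSq ((x:ℂ) - c + r c * I) = (x - c) ^ 2 + (r c) ^ 2 := by
    simp [Complex.normSq_apply]
    ring
  rw [h2]
  have h3 : (x - c) ^ 2 ≤ (r c) ^ 2 := sq_le_sq' (by linarith [neg_abs_le (x - c)]) (by
    linarith [le_abs_self (x - c)])
  simp only [ofReal_im, zero_add]
  rw [← mul_div_assoc, div_le_div_iff₀ (by norm_num) (by positivity)]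
  nlinarith

lemma HH_norm_far {t : Finset ℝ} {r : ℝ → ℝ} {M ε d : ℝ} (hM : 0 ≤ M) (hr : ∀ c ∈ t, 0 < r c)
    (hs : ∑ c ∈ t, r c ≤ ε) (hd : 0 < d) (hε : ε ≤ d / 2) {z : ℂ}
    (hz : ∀ c ∈ t, d ≤ ‖z - c‖) : ‖HH t r M z‖ ≤ M * ε * (2 / d) := by
  unfold HH
  refine (norm_sum_le _ _).trans ?_
  have : ∀ c ∈ t, ‖((M * r c : ℝ) : ℂ) * resol c (r c) z‖ ≤ M * r c * (2 / d) := by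
    intro c hc
    have h2 := hr c hc
    rw [norm_mul, Complex.norm_real, Real.norm_eq_abs, abs_of_nonneg (by positivity)]
    gcongr
    rw [resol_norm, div_le_div_iff₀ _ hd]
    all_goals
      have h3 := norm_sub_le (z - c + r c * I) (r c * I)
      have h4 := Finset.single_le_sum (fun i hi => (hr i hi).le) hc
      have h5 := hz c hc
      simp only [add_sub_cancel_right, norm_mul, Complex.norm_real, Complex.norm_I, mul_one,
        Real.norm_eq_abs, abs_of_pos h2] at h3
      linarith
  refine (Finset.sum_le_sum this).trans ?_
  rw [← Finset.sum_mul, ← Finset.mul_sum]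
  gcongr

lemma Annih.compact_null [SFinite m] {w : X → ℂ} (h : Annih m z w) (hzm : Measurable z)
    (hz : ∀ x, 0 ≤ (z x).im) {E : Set ℝ} (hE : IsCompact E) (hE0 : volume E = 0) :
    ∫ x in z ⁻¹' (Set.image Complex.ofReal E), w x ∂m = 0 := by
  have hEc : IsCompact (Set.image Complex.ofReal E) := hE.image Complex.continuous_ofReal
  have hEm : MeasurableSet (z ⁻¹' (Set.image Complex.ofReal E)) := hzm hEc.measurableSet
  have hex := fun n : ℕ => cover_null hE hE0 (ε := 1 / ((n : ℝ) + 1) ^ 2) (by positivity)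
  choose t r htr hsum hcov using hex
  have hr : ∀ n, ∀ c ∈ t n, 0 < r n c := fun n c hc => (htr n c hc).2
  set H : ℕ → ℂ → ℂ := fun n => _root_.HH (t n) (r n) ((n : ℝ) + 1) with hH
  have hHm : ∀ n, Measurable (H n) := fun n => HH_meas _ _ _
  have hre : ∀ n x, ‖Complex.exp (-H n (z x))‖ ≤ 1 := by
    intro n x
    rw [Complex.norm_exp]
    have := HH_re_nonneg (M := (n : ℝ) + 1) (by positivity) (hr n) (hz x)
    simpa using this
  have hzero : ∀ n, ∫ x, (1 - Complex.exp (-H n (z x))) * w x ∂m = 0 := by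
    intro n
    simp_rw [sub_mul, one_mul]
    rw [integral_sub h.1, h.exp_HH hzm hz (by positivity) (hr n), sub_zero]
    · simpa using h.2 0 le_rfl
    · exact Annih.bdd_int h.1 (Measurable.aestronglyMeasurable (by fun_prop)) (hre n)
  rw [← integral_indicator hEm]
  refine tendsto_nhds_unique (tendsto_integral_of_dominated_convergence
    (F := fun n x => (1 - Complex.exp (-H n (z x))) * w x) (fun x => 2 * ‖w x‖) ?_ ?_ ?_ ?_) ?_
  · intro n
    exact AEStronglyMeasurable.mul (Measurable.aestronglyMeasurable (by fun_prop)) h.1.1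
  · exact h.1.norm.const_mul 2
  · intro n
    refine Eventually.of_forall fun x => ?_
    rw [norm_mul]
    gcongr
    refine (norm_sub_le _ _).trans ?_
    have := hre n x
    simp only [norm_one]
    linarith
  · refine Eventually.of_forall fun x => ?_
    have hn1 : Tendsto (fun n : ℕ => (n : ℝ) + 1) atTop atTop :=
      tendsto_atTop_add_const_right _ _ tendsto_natCast_atTop_atTop
    by_cases hx : z x ∈ Set.image Complex.ofReal E
    · rw [indicator_of_mem (by exact hx)]
      obtain ⟨y, hy, hyx⟩ := hx
      have : Tendsto (fun n => Complex.exp (-H n (z x))) atTop (𝓝 0) := by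
        rw [Complex.tendsto_exp_nhds_zero_iff]
        simp only [neg_re]
        apply tendsto_neg_atTop_atBot.comp
        refine tendsto_atTop_mono (f := fun n : ℕ => ((n : ℝ) + 1) / 2) ?_
          (hn1.atTop_div_const (by norm_num))
        intro n
        rw [← hyx]
        exact HH_re_ge (by positivity) (hr n) (hcov n y hy)
      simpa using (this.const_sub 1).mul_const (w x)
    · rw [indicator_of_notMem (by exact hx)]
      obtain ⟨d, hd, hdx⟩ := Metric.nhds_basis_ball.mem_iff.1 (hEc.isClosed.isOpen_compl.mem_nhds hx)
      have hdE : ∀ c ∈ E, d ≤ ‖z x - c‖ := by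
        intro c hc
        by_contra hlt
        push Not at hlt
        have : (c : ℂ) ∈ Metric.ball (z x) d := by
          rw [Metric.mem_ball, dist_comm, dist_eq_norm]; exact hlt
        exact hdx this ⟨c, hc, rfl⟩
      have h0 : Tendsto (fun n => H n (z x)) atTop (𝓝 0) := by
        have hinv : Tendsto (fun n : ℕ => 1 / ((n : ℝ) + 1)) atTop (𝓝 0) :=
          tendsto_one_div_add_atTop_nhds_zero_nat
        have hinv2 : Tendsto (fun n : ℕ => 1 / ((n : ℝ) + 1) ^ 2) atTop (𝓝 0) := by
          have := hinv.pow 2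
          simpa using this
        have hlim : Tendsto (fun n : ℕ => 1 / ((n : ℝ) + 1) * (2 / d)) atTop (𝓝 0) := by
          simpa using hinv.mul_const (2 / d)
        refine squeeze_zero_norm' ?_ hlim
        filter_upwards [hinv2.eventually (ge_mem_nhds (by positivity : 0 < d / 2))] with n hn
        refine (HH_norm_far (by positivity) (hr n) (hsum n) hd hn
          (fun c hc => hdE c (htr n c hc).1)).trans (le_of_eq ?_)
        field_simp
      have h1 : Tendsto (fun n => Complex.exp (-H n (z x))) atTop (𝓝 1) := by
        have := (Complex.continuous_exp.tendsto _).comp h0.neg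
        simpa [Function.comp_def] using this
      simpa using (h1.const_sub 1).mul_const (w x)
  · simp_rw [hzero]
    exact tendsto_const_nhds

def glue (μ : Fin 4 → Measure ℝ) : Measure (Fin 4 × ℝ) := Measure.sum fun j => (μ j).map (Prod.mk j)

instance glue_sfinite (μ : Fin 4 → Measure ℝ) [∀ j, SFinite (μ j)] : SFinite (glue μ) := by
  unfold glue
  infer_instance

lemma glue_integrable (μ : Fin 4 → Measure ℝ) {F : Fin 4 × ℝ → ℂ}
    (hF : ∀ j, Integrable (fun x => F (j, x)) (μ j)) : Integrable F (glue μ) := by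
  unfold glue
  rw [Measure.sum_fintype, integrable_finsetSum_measure]
  intro j _
  rw [(measurableEmbedding_prodMk_left j).integrable_map_iff]
  exact hF j

lemma glue_integral (μ : Fin 4 → Measure ℝ) {F : Fin 4 × ℝ → ℂ}
    (hF : ∀ j, Integrable (fun x => F (j, x)) (μ j)) :
    ∫ p, F p ∂(glue μ) = ∑ j, ∫ x, F (j, x) ∂(μ j) := by
  unfold glue
  rw [Measure.sum_fintype, integral_finsetSum_measure]
  · refine Finset.sum_congr rfl fun j _ => ?_
    rw [(measurableEmbedding_prodMk_left j).integral_map]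
  · intro j _
    rw [(measurableEmbedding_prodMk_left j).integrable_map_iff]
    exact hF j

lemma ac_of_compact (ρ : Measure ℝ) [IsFiniteMeasure ρ] {u : ℝ → ℂ} (hu : Integrable u ρ)
    (h : ∀ E : Set ℝ, IsCompact E → volume E = 0 → ∫ x in E, u x ∂ρ = 0) :
    ∃ g : ℝ → ℂ, Integrable g volume ∧
      ∀ φ : SchwartzMap ℝ ℂ, (∫ x, φ x * u x ∂ρ) = ∫ x : ℝ, φ x * g x := by
  have hnull : ∀ S : Set ℝ, MeasurableSet S → volume S = 0 → ∫ x in S, u x ∂ρ = 0 := by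
    intro S hS hS0
    have hκ : IsFiniteMeasure (ρ.withDensity fun x => ‖u x‖ₑ) :=
      isFiniteMeasure_withDensity hu.2.ne
    by_contra hne
    have hpos : ‖∫ x in S, u x ∂ρ‖ₑ ≠ 0 := by simpa using hne
    obtain ⟨K, hKS, hK, hlt⟩ := hS.exists_isCompact_sdiff_lt
      (μ := ρ.withDensity fun x => ‖u x‖ₑ) (measure_ne_top _ _) hpos
    have h1 : ∫ x in S, u x ∂ρ = ∫ x in S \ K, u x ∂ρ := by
      rw [setIntegral_sdiff hK.measurableSet hu.integrableOn hKS,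
        h K hK (measure_mono_null hKS hS0), sub_zero]
    rw [withDensity_apply _ (hS.diff hK.measurableSet)] at hlt
    rw [h1] at hlt
    exact absurd hlt (not_lt.2 (enorm_integral_le_lintegral_enorm _))
  set s := ρ.singularPart volume with hs
  set d := ρ.rnDeriv volume with hd
  have hdec : s + volume.withDensity d = ρ := ρ.singularPart_add_rnDeriv volume
  have hus : Integrable u s := hu.mono_measure (Measure.singularPart_le _ _)
  have hud : Integrable u (volume.withDensity d) :=
    hu.mono_measure (Measure.withDensity_rnDeriv_le _ _)
  have hu0 : u =ᵐ[s] 0 := by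
    obtain ⟨N, hN, hN1, hN2⟩ := ρ.mutuallySingular_singularPart volume
    apply ae_eq_zero_of_forall_setIntegral_eq_of_sigmaFinite
    · intro S _ _
      exact hus.integrableOn
    · intro S hS _
      have hSN : volume (S ∩ Nᶜ) = 0 := measure_mono_null inter_subset_right hN2
      have h1 := hnull (S ∩ Nᶜ) (hS.inter hN.compl) hSN
      rw [← hdec, Measure.restrict_add, integral_add_measure hus.integrableOn hud.integrableOn] at h1
      have h2 : (volume.withDensity d).restrict (S ∩ Nᶜ) = 0 := by
        rw [Measure.restrict_eq_zero]
        exact withDensity_absolutelyContinuous _ _ hSN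
      rw [h2, integral_zero_measure, add_zero] at h1
      rw [← h1]
      apply setIntegral_congr_set
      have h3 : (Nᶜ : Set ℝ) =ᵐ[s] univ := by
        rw [ae_eq_univ, compl_compl]
        exact hN1
      simpa using (ae_eq_refl S).inter h3.symm
  have hlt := ρ.rnDeriv_lt_top volume
  have hdm := ρ.measurable_rnDeriv volume
  refine ⟨fun x => (d x).toReal • u x, ?_, fun φ => ?_⟩
  · exact (integrable_withDensity_iff_integrable_smul' hdm hlt).1 hud
  · have hb : ∀ {ν : Measure ℝ}, Integrable u ν → Integrable (fun x => φ x * u x) ν := by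
      intro ν hν
      refine hν.bdd_mul (c := SchwartzMap.seminorm ℝ 0 0 φ) φ.continuous.aestronglyMeasurable
        (Eventually.of_forall fun x => ?_)
      simpa using φ.le_seminorm ℝ 0 0 x
    rw [← hdec, integral_add_measure (hb hus) (hb hud),
      integral_withDensity_eq_integral_toReal_smul hdm hlt]
    have : ∫ x, φ x * u x ∂s = 0 := by
      apply integral_eq_zero_of_ae
      filter_upwards [hu0] with x hx
      simp [hx]
    rw [this, zero_add]
    congr 1 with x
    simp only [Complex.real_smul]
    ring

lemma fInt_eq (φ : ℝ → ℂ) (x : ℝ) : fInt φ x = FourierTransform.fourier φ (x / (2 * π)) := by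
  rw [Real.fourier_real_eq_integral_exp_smul]
  unfold fInt
  congr 1 with k
  rw [smul_eq_mul, mul_comm]
  congr 2
  have : (π : ℂ) ≠ 0 := by exact_mod_cast Real.pi_ne_zero
  push_cast
  field_simp

lemma fInt_prop {φ : ℝ → ℂ} (hφ : ContDiff ℝ (⊤ : ℕ∞) φ) (hc : HasCompactSupport φ) :
    Integrable (fInt φ) volume ∧ Continuous (fInt φ) ∧ ∃ C, ∀ x, ‖fInt φ x‖ ≤ C := by
  let S : SchwartzMap ℝ ℂ := hc.toSchwartzMap hφ
  have hS : fInt φ = fun x => (FourierTransform.fourier S) (x / (2 * π)) := by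
    ext x
    rw [fInt_eq, SchwartzMap.fourier_coe]
    rfl
  rw [hS]
  refine ⟨(FourierTransform.fourier S).integrable.comp_div (by positivity), ?_, ?_⟩
  · exact (FourierTransform.fourier S).continuous.comp (by fun_prop)
  · refine ⟨SchwartzMap.seminorm ℝ 0 0 (FourierTransform.fourier S), fun x => ?_⟩
    simpa using (FourierTransform.fourier S).le_seminorm ℝ 0 0 (x / (2 * π))

lemma fInt_shift (φ : ℝ → ℂ) (a x : ℝ) :
    fInt (fun k => φ (k + a)) x = Complex.exp (I * a * x) * fInt φ x := by
  unfold fInt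
  rw [← integral_add_right_eq_self (fun k => φ k * Complex.exp (-(I * k * x))) a,
    ← integral_const_mul]
  congr 1 with k
  rw [mul_left_comm, ← Complex.exp_add]
  congr 2
  push_cast
  ring

lemma fInt_shift' (φ : ℝ → ℂ) (a x : ℝ) :
    fInt (fun k => Real.exp k * φ (k + a)) x =
      Complex.exp (I * a * (x + I)) * fInt (fun k => Real.exp k * φ k) x := by
  have h := fInt_shift (fun k => Real.exp k * φ k) a x
  have h2 : fInt (fun k => Real.exp k * φ (k + a)) x
      = Complex.exp (-a) * fInt (fun k => Real.exp (k + a) * φ (k + a)) x := by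
    unfold fInt
    rw [← integral_const_mul]
    congr 1 with k
    rw [← mul_assoc, ← mul_assoc]
    congr 2
    push_cast
    rw [← Complex.exp_add]
    congr 1
    ring
  rw [h2]
  push_cast at h ⊢
  rw [h, ← mul_assoc, ← Complex.exp_add]
  congr 2
  linear_combination (-(a : ℂ)) * I_mul_I

def FTHyp (ρ₀ ρ₁ : Measure ℝ) (u₀ u₁ f₀ f₁ : ℝ → ℂ) : Prop :=
  ∀ φ : ℝ → ℂ, ContDiff ℝ (⊤ : ℕ∞) φ → HasCompactSupport φ →
      ((∫ x, fInt φ x * u₁ x ∂ρ₁) + ∫ x : ℝ, fInt φ x * f₁ x) =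
        ((∫ x, fInt (fun k => Real.exp k * φ k) x * u₀ x ∂ρ₀) +
          ∫ x : ℝ, fInt (fun k => Real.exp k * φ k) x * f₀ x)

lemma exp_mul_prop {φ : ℝ → ℂ} (hφ : ContDiff ℝ (⊤ : ℕ∞) φ) (hc : HasCompactSupport φ) :
    ContDiff ℝ (⊤ : ℕ∞) (fun k => (Real.exp k : ℂ) * φ k) ∧
      HasCompactSupport (fun k => (Real.exp k : ℂ) * φ k) := by
  refine ⟨ContDiff.mul ?_ hφ, hc.mul_left⟩
  exact Complex.ofRealCLM.contDiff.comp Real.contDiff_exp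

lemma half_phi (ρ₀ ρ₁ : Measure ℝ) [IsFiniteMeasure ρ₀] [IsFiniteMeasure ρ₁]
    (u₀ u₁ f₀ f₁ : ℝ → ℂ) (hu₀ : Integrable u₀ ρ₀) (hu₁ : Integrable u₁ ρ₁)
    (hf₀ : MemLp f₀ ⊤ volume) (hf₁ : MemLp f₁ ⊤ volume) (hFT : FTHyp ρ₀ ρ₁ u₀ u₁ f₀ f₁)
    {φ : ℝ → ℂ} (hφ : ContDiff ℝ (⊤ : ℕ∞) φ) (hc : HasCompactSupport φ)
    {E : Set ℝ} (hE : IsCompact E) (hE0 : volume E = 0) :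
    ∫ x in E, fInt φ x * u₁ x ∂ρ₁ = 0 := by
  obtain ⟨hGi, hGc, C, hGb⟩ := fInt_prop hφ hc
  obtain ⟨hφ', hc'⟩ := exp_mul_prop hφ hc
  obtain ⟨hGi', hGc', C', hGb'⟩ := fInt_prop hφ' hc'
  set G := fInt φ with hG
  set G' := fInt (fun k => (Real.exp k : ℂ) * φ k) with hG'
  let μ : Fin 4 → Measure ℝ := ![ρ₁, volume, ρ₀, volume]
  have hμs : ∀ j, SFinite (μ j) := by
    intro j
    fin_cases j <;> simp [μ] <;> infer_instance
  let zz : Fin 4 → ℂ := ![0, 0, I, I]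
  let z : Fin 4 × ℝ → ℂ := fun p => p.2 + zz p.1
  let ww : Fin 4 → ℝ → ℂ := ![fun x => G x * u₁ x, fun x => G x * f₁ x,
    fun x => -(G' x * u₀ x), fun x => -(G' x * f₀ x)]
  let w : Fin 4 × ℝ → ℂ := fun p => ww p.1 p.2
  have hzm : Measurable z := by
    have : Measurable zz := Measurable.of_discrete
    fun_prop
  have hz : ∀ p, 0 ≤ (z p).im := by
    rintro ⟨j, x⟩
    fin_cases j <;> simp [z, zz]
  have hwi : ∀ j, Integrable (fun x => w (j, x)) (μ j) := by
    intro j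
    fin_cases j
    · exact hu₁.bdd_mul (c := C) hGc.aestronglyMeasurable (Eventually.of_forall hGb)
    · exact hGi.mul_of_top_left hf₁
    · exact (hu₀.bdd_mul (c := C') hGc'.aestronglyMeasurable (Eventually.of_forall hGb')).neg
    · exact (hGi'.mul_of_top_left hf₀).neg
  have hann : Annih (glue μ) z w := by
    refine ⟨glue_integrable μ hwi, fun a ha => ?_⟩
    rw [glue_integral]
    · have h := hFT (fun k => φ (k + a)) (hφ.comp (by fun_prop))
        (hc.comp_homeomorph (Homeomorph.addRight a))
      simp_rw [fInt_shift, fInt_shift'] at h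
      rw [← sub_eq_zero] at h
      rw [← h, Fin.sum_univ_four]
      simp only [μ, z, zz, w, ww, Matrix.cons_val, mul_neg, integral_neg, add_zero, mul_assoc]
      ring
    · intro j
      have := hwi j
      refine this.bdd_mul (c := 1) (Measurable.aestronglyMeasurable (by fun_prop))
        (Eventually.of_forall fun x => norm_exp_le ha (hz (j, x)))
  have hfin := hann.compact_null hzm hz hE hE0
  have hEm : MeasurableSet (z ⁻¹' (Set.image Complex.ofReal E)) :=
    hzm (hE.image Complex.continuous_ofReal).measurableSet
  rw [← integral_indicator hEm, glue_integral] at hfin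
  · have e0 : ∀ x : ℝ, (z ⁻¹' (Set.image Complex.ofReal E)).indicator w (0, x) =
        E.indicator (fun x => G x * u₁ x) x := by
      intro x
      by_cases hx : x ∈ E <;> simp [indicator, z, zz, w, ww, hx]
    have e1 : ∀ x : ℝ, (z ⁻¹' (Set.image Complex.ofReal E)).indicator w (1, x) =
        E.indicator (fun x => G x * f₁ x) x := by
      intro x
      by_cases hx : x ∈ E <;> simp [indicator, z, zz, w, ww, hx]
    have e2 : ∀ x : ℝ, (z ⁻¹' (Set.image Complex.ofReal E)).indicator w (2, x) = 0 := by
      intro x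
      apply indicator_of_notMem
      rintro ⟨y, _, hy⟩
      have := congrArg Complex.im hy
      simp [z, zz] at this
    have e3 : ∀ x : ℝ, (z ⁻¹' (Set.image Complex.ofReal E)).indicator w (3, x) = 0 := by
      intro x
      apply indicator_of_notMem
      rintro ⟨y, _, hy⟩
      have := congrArg Complex.im hy
      simp [z, zz] at this
    rw [Fin.sum_univ_four] at hfin
    simp_rw [e0, e1, e2, e3] at hfin
    rw [integral_indicator hE.measurableSet, integral_indicator hE.measurableSet] at hfin
    simpa [μ, Measure.restrict_eq_zero.2 hE0] using hfin
  · intro j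
    exact (hwi j).indicator (s := (fun x => (j, x)) ⁻¹' (z ⁻¹' (Set.image Complex.ofReal E)))
      (measurable_prodMk_left hEm)

lemma half (ρ₀ ρ₁ : Measure ℝ) [IsFiniteMeasure ρ₀] [IsFiniteMeasure ρ₁]
    (u₀ u₁ f₀ f₁ : ℝ → ℂ) (hu₀ : Integrable u₀ ρ₀) (hu₁ : Integrable u₁ ρ₁)
    (hf₀ : MemLp f₀ ⊤ volume) (hf₁ : MemLp f₁ ⊤ volume) (hFT : FTHyp ρ₀ ρ₁ u₀ u₁ f₀ f₁)
    {E : Set ℝ} (hE : IsCompact E) (hE0 : volume E = 0) :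
    ∫ x in E, u₁ x ∂ρ₁ = 0 := by
  let b : ℕ → ContDiffBump (0 : ℝ) := fun n =>
    ⟨1 / ((n : ℝ) + 1) / 2, 1 / ((n : ℝ) + 1), by positivity, by
      have : 0 < 1 / ((n : ℝ) + 1) := by positivity
      linarith⟩
  let φ : ℕ → ℝ → ℂ := fun n k => ((b n).normed volume k : ℂ)
  have hφ : ∀ n, ContDiff ℝ (⊤ : ℕ∞) (φ n) := fun n =>
    Complex.ofRealCLM.contDiff.comp (b n).contDiff_normed
  have hc : ∀ n, HasCompactSupport (φ n) := fun n =>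
    (b n).hasCompactSupport_normed.comp_left (g := Complex.ofReal) (by simp)
  refine tendsto_nhds_unique (tendsto_integral_of_dominated_convergence (μ := ρ₁.restrict E)
    (F := fun n x => fInt (φ n) x * u₁ x) (fun x => ‖u₁ x‖) ?_ ?_ ?_ ?_) ?_
  · intro n
    exact (fInt_prop (hφ n) (hc n)).2.1.aestronglyMeasurable.mul hu₁.1.restrict
  · exact hu₁.norm.restrict
  · intro n
    refine Eventually.of_forall fun x => ?_
    rw [norm_mul]
    refine mul_le_of_le_one_left (norm_nonneg _) ?_
    refine (norm_integral_le_integral_norm _).trans (le_of_eq ?_)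
    rw [← (b n).integral_normed (μ := volume)]
    congr 1 with k
    rw [norm_mul, Complex.norm_exp]
    simp [φ, abs_of_nonneg ((b n).nonneg_normed k)]
  · refine Eventually.of_forall fun x => ?_
    have h := ContDiffBump.convolution_tendsto_right_of_continuous (φ := b) (l := atTop)
      (μ := (volume : Measure ℝ)) (g := fun k : ℝ => Complex.exp (I * k * x))
      tendsto_one_div_add_atTop_nhds_zero_nat (by fun_prop) 0
    have h2 : Tendsto (fun n => fInt (φ n) x) atTop (𝓝 1) := by
      have e : (fun n => fInt (φ n) x) = fun n => (MeasureTheory.convolution ((b n).normed volume)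
          (fun k : ℝ => Complex.exp (I * k * x)) (ContinuousLinearMap.lsmul ℝ ℝ) volume 0) := by
        ext n
        unfold fInt MeasureTheory.convolution
        congr 1 with k
        simp [φ]
      rw [e]
      simpa using h
    simpa using h2.mul_const (u₁ x)
  · simp_rw [half_phi ρ₀ ρ₁ u₀ u₁ f₀ f₁ hu₀ hu₁ hf₀ hf₁ hFT (hφ _) (hc _) hE hE0]
    exact tendsto_const_nhds

lemma fInt_neg (φ : ℝ → ℂ) (x : ℝ) : fInt φ (-x) = fInt (fun k => φ (-k)) x := by
  unfold fInt
  rw [← integral_neg_eq_self]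
  congr 1 with k
  push_cast
  congr 2
  ring

lemma FTHyp.reflect {ρ₀ ρ₁ : Measure ℝ} {u₀ u₁ f₀ f₁ : ℝ → ℂ} (h : FTHyp ρ₀ ρ₁ u₀ u₁ f₀ f₁) :
    FTHyp (ρ₁.map Neg.neg) (ρ₀.map Neg.neg) (fun x => u₁ (-x)) (fun x => u₀ (-x))
      (fun x => f₁ (-x)) (fun x => f₀ (-x)) := by
  intro ψ hψ hc
  have hn : MeasurableEmbedding (Neg.neg : ℝ → ℝ) := (MeasurableEquiv.neg ℝ).measurableEmbedding
  rw [hn.integral_map, hn.integral_map,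
    ← integral_neg_eq_self (fun x => fInt ψ x * f₀ (-x)),
    ← integral_neg_eq_self (fun x => fInt (fun k => Real.exp k * ψ k) x * f₁ (-x))]
  simp only [neg_neg, fInt_neg]
  have h1 := (exp_mul_prop hψ hc).1
  have h2 := (exp_mul_prop hψ hc).2
  have h3 := h (fun k => Real.exp (-k) * ψ (-k)) (h1.comp contDiff_neg)
    (h2.comp_homeomorph (Homeomorph.neg ℝ))
  have e : ∀ k : ℝ, (Real.exp k : ℂ) * (Real.exp (-k) * ψ (-k)) = ψ (-k) := by
    intro k
    rw [← mul_assoc, ← Complex.ofReal_mul, ← Real.exp_add]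
    simp
  simp_rw [e] at h3
  exact h3.symm

end Helpers

/-- **Absolute continuity of measures with one-sided exponentially weighted Fourier
transform** (Lemma A.1).  A complex measure is encoded as `u ∂ρ` with `ρ` a finite
measure and `u` an integrable density. -/
theorem abs_continuity (ρ₀ ρ₁ : Measure ℝ) [IsFiniteMeasure ρ₀] [IsFiniteMeasure ρ₁]
    (u₀ u₁ f₀ f₁ : ℝ → ℂ) (hu₀ : Integrable u₀ ρ₀) (hu₁ : Integrable u₁ ρ₁)
    (hf₀ : MemLp f₀ ⊤ volume) (hf₁ : MemLp f₁ ⊤ volume)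
    (hFT : ∀ φ : ℝ → ℂ, ContDiff ℝ (⊤ : ℕ∞) φ → HasCompactSupport φ →
      ((∫ x, fInt φ x * u₁ x ∂ρ₁) + ∫ x : ℝ, fInt φ x * f₁ x) =
        ((∫ x, fInt (fun k => Real.exp k * φ k) x * u₀ x ∂ρ₀) +
          ∫ x : ℝ, fInt (fun k => Real.exp k * φ k) x * f₀ x)) :
    (∃ g₀ b₀ : ℝ → ℂ, Integrable g₀ volume ∧ MemLp b₀ ⊤ volume ∧
      ∀ φ : SchwartzMap ℝ ℂ,
        ((∫ x, φ x * u₀ x ∂ρ₀) + ∫ x : ℝ, φ x * f₀ x) =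
          ∫ x : ℝ, φ x * (g₀ x + b₀ x)) ∧
    (∃ g₁ b₁ : ℝ → ℂ, Integrable g₁ volume ∧ MemLp b₁ ⊤ volume ∧
      ∀ φ : SchwartzMap ℝ ℂ,
        ((∫ x, φ x * u₁ x ∂ρ₁) + ∫ x : ℝ, φ x * f₁ x) =
          ∫ x : ℝ, φ x * (g₁ x + b₁ x)) ∧
    ((f₀ = 0 ∧ f₁ = 0) →
      (∃ g₀ : ℝ → ℂ, Integrable g₀ volume ∧
        ∀ φ : SchwartzMap ℝ ℂ, (∫ x, φ x * u₀ x ∂ρ₀) = ∫ x : ℝ, φ x * g₀ x) ∧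
      (∃ g₁ : ℝ → ℂ, Integrable g₁ volume ∧
        ∀ φ : SchwartzMap ℝ ℂ, (∫ x, φ x * u₁ x ∂ρ₁) = ∫ x : ℝ, φ x * g₁ x)) := by
  have hFT' : FTHyp ρ₀ ρ₁ u₀ u₁ f₀ f₁ := hFT
  obtain ⟨g₁, hg₁, hg₁'⟩ := ac_of_compact ρ₁ hu₁
    (fun E hE hE0 => half ρ₀ ρ₁ u₀ u₁ f₀ f₁ hu₀ hu₁ hf₀ hf₁ hFT' hE hE0)
  have hn : MeasurableEmbedding (Neg.neg : ℝ → ℝ) := (MeasurableEquiv.neg ℝ).measurableEmbedding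
  have hnp : MeasurePreserving (Neg.neg : ℝ → ℝ) volume volume :=
    Measure.measurePreserving_neg volume
  obtain ⟨g₀, hg₀, hg₀'⟩ := ac_of_compact ρ₀ hu₀ (fun E hE hE0 => by
    have hi : ∀ {ρ : Measure ℝ} {u : ℝ → ℂ}, Integrable u ρ →
        Integrable (fun x => u (-x)) (ρ.map Neg.neg) := by
      intro ρ u hu
      rw [hn.integrable_map_iff]
      simpa [Function.comp_def] using hu
    have hb : ∀ {f : ℝ → ℂ}, MemLp f ⊤ volume → MemLp (fun x => f (-x)) ⊤ volume :=
      fun hf => hf.comp_measurePreserving hnp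
    have hE' : IsCompact (Neg.neg ⁻¹' E) := (Homeomorph.neg ℝ).isCompact_preimage.2 hE
    have := half _ _ _ _ _ _ (hi hu₁) (hi hu₀) (hb hf₁) (hb hf₀) hFT'.reflect hE'
      (by rw [hnp.measure_preimage hE.measurableSet.nullMeasurableSet, hE0])
    rw [hn.setIntegral_map] at this
    simpa [preimage_preimage] using this)
  have hadd : ∀ {g f : ℝ → ℂ} (φ : SchwartzMap ℝ ℂ), Integrable g volume → MemLp f ⊤ volume →
      ∫ x : ℝ, φ x * (g x + f x) = (∫ x : ℝ, φ x * g x) + ∫ x : ℝ, φ x * f x := by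
    intro g f φ hg hf
    simp_rw [mul_add]
    rw [integral_add]
    · refine hg.bdd_mul (c := SchwartzMap.seminorm ℝ 0 0 φ) φ.continuous.aestronglyMeasurable
        (Eventually.of_forall fun x => ?_)
      simpa using φ.le_seminorm ℝ 0 0 x
    · exact φ.integrable.mul_of_top_left hf
  refine ⟨⟨g₀, f₀, hg₀, hf₀, fun φ => ?_⟩, ⟨g₁, f₁, hg₁, hf₁, fun φ => ?_⟩,
    fun _ => ⟨⟨g₀, hg₀, hg₀'⟩, ⟨g₁, hg₁, hg₁'⟩⟩⟩
  · rw [hadd φ hg₀ hf₀, hg₀']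
  · rw [hadd φ hg₁ hf₁, hg₁']
end
end
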